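/- arXiv:math/0511297 — 4 statements merged into one kernel-verified Lean document; each statement's English description precedes it below -/
import Mathlib

section
/- If T is a basic functional in L(G(ℝ^n),ℂ̃), defined by a net (T_ε) of compactly supported distributions, and u ∈ G_S(ℝ^n), then the convolution u∗T defined by (u∗T)(x) := T(u(x−·)), i.e. with representative x ↦ T_ε(u_ε(x−·)), belongs to G_S(ℝ^n): the net (T_ε(u_ε(x−·)))_ε is a moderate net of Schwartz functions. -/
noncomputable section

open Set MeasureTheory Topology

/-- Euclidean space `ℝ^n`. -/
abbrev Rn (n : ℕ) := EuclideanSpace ℝ (Fin n)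

namespace Colombeau

/-- A net of smooth functions on the open set `Ω ⊆ E` is *moderate*:
for every compact `K ⊆ Ω` and derivative order `i` there is `N` with
`sup_{x∈K} ‖∂^i u_ε(x)‖ = O(ε^{-N})` as `ε → 0`. -/
def IsModerate {E : Type} [NormedAddCommGroup E] [NormedSpace ℝ E]
    (Ω : Set E) (u : ℝ → E → ℂ) : Prop :=
  (∀ ε ∈ Ioc (0:ℝ) 1, ContDiffOn ℝ (⊤ : ℕ∞) (u ε) Ω) ∧
  ∀ K : Set E, IsCompact K → K ⊆ Ω → ∀ i : ℕ,
    ∃ N : ℕ, ∃ c > 0, ∃ η ∈ Ioc (0:ℝ) 1, ∀ ε ∈ Ioc (0:ℝ) η, ∀ x ∈ K,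
      ‖iteratedFDeriv ℝ i (u ε) x‖ ≤ c * ε ^ (-(N:ℝ))

/-- A net of smooth functions on `Ω` is *negligible*:
for every compact `K ⊆ Ω`, derivative order `i` and every `q`,
`sup_{x∈K} ‖∂^i u_ε(x)‖ = O(ε^q)` as `ε → 0`. -/
def IsNegligible {E : Type} [NormedAddCommGroup E] [NormedSpace ℝ E]
    (Ω : Set E) (u : ℝ → E → ℂ) : Prop :=
  (∀ ε ∈ Ioc (0:ℝ) 1, ContDiffOn ℝ (⊤ : ℕ∞) (u ε) Ω) ∧
  ∀ K : Set E, IsCompact K → K ⊆ Ω → ∀ i : ℕ, ∀ q : ℕ,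
    ∃ c > 0, ∃ η ∈ Ioc (0:ℝ) 1, ∀ ε ∈ Ioc (0:ℝ) η, ∀ x ∈ K,
      ‖iteratedFDeriv ℝ i (u ε) x‖ ≤ c * ε ^ (q:ℝ)

/-- `G^∞`-moderateness: on each compact set the exponent `N` is uniform in the
derivative order. -/
def IsGinfModerate {E : Type} [NormedAddCommGroup E] [NormedSpace ℝ E]
    (Ω : Set E) (u : ℝ → E → ℂ) : Prop :=
  (∀ ε ∈ Ioc (0:ℝ) 1, ContDiffOn ℝ (⊤ : ℕ∞) (u ε) Ω) ∧
  ∀ K : Set E, IsCompact K → K ⊆ Ω → ∃ N : ℕ, ∀ i : ℕ,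
    ∃ c > 0, ∃ η ∈ Ioc (0:ℝ) 1, ∀ ε ∈ Ioc (0:ℝ) η, ∀ x ∈ K,
      ‖iteratedFDeriv ℝ i (u ε) x‖ ≤ c * ε ^ (-(N:ℝ))

/-- The net `u` has all its supports contained in one fixed compact subset of `Ω`. -/
def HasCmpSupp {E : Type} [NormedAddCommGroup E] [NormedSpace ℝ E]
    (Ω : Set E) (u : ℝ → E → ℂ) : Prop :=
  ∃ K : Set E, IsCompact K ∧ K ⊆ Ω ∧ ∀ ε ∈ Ioc (0:ℝ) 1, tsupport (u ε) ⊆ K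

/-- Moderate nets of complex numbers (representatives of elements of `ℂ̃`). -/
def CIsModerate (z : ℝ → ℂ) : Prop :=
  ∃ N : ℕ, ∃ c > 0, ∃ η ∈ Ioc (0:ℝ) 1, ∀ ε ∈ Ioc (0:ℝ) η, ‖z ε‖ ≤ c * ε ^ (-(N:ℝ))

/-- Negligible nets of complex numbers. -/
def CIsNegligible (z : ℝ → ℂ) : Prop :=
  ∀ q : ℕ, ∃ c > 0, ∃ η ∈ Ioc (0:ℝ) 1, ∀ ε ∈ Ioc (0:ℝ) η, ‖z ε‖ ≤ c * ε ^ (q:ℝ)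

/-- `S` is a distribution on `Ω`: for each compact `K ⊆ Ω` it is continuous with respect
to some seminorm `sup_{x∈K, |α|≤j} |∂^α f(x)|` on smooth functions supported in `K`. -/
def IsDistributionOn {n : ℕ} (Ω : Set (Rn n)) (S : (Rn n → ℂ) →ₗ[ℂ] ℂ) : Prop :=
  ∀ K : Set (Rn n), IsCompact K → K ⊆ Ω →
    ∃ j : ℕ, ∃ C : ℝ, 0 ≤ C ∧ ∀ f : Rn n → ℂ, ContDiffOn ℝ (⊤ : ℕ∞) f Ω → tsupport f ⊆ K →
      ∀ B : ℝ, (∀ x ∈ K, ∀ i ≤ j, ‖iteratedFDeriv ℝ i f x‖ ≤ B) → ‖S f‖ ≤ C * B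

/-- `S` is a compactly supported distribution on `Ω`. -/
def IsCptSuppDistributionOn {n : ℕ} (Ω : Set (Rn n)) (S : (Rn n → ℂ) →ₗ[ℂ] ℂ) : Prop :=
  ∃ K : Set (Rn n), IsCompact K ∧ K ⊆ Ω ∧
    ∃ j : ℕ, ∃ C : ℝ, 0 ≤ C ∧ ∀ f : Rn n → ℂ, ContDiffOn ℝ (⊤ : ℕ∞) f Ω →
      ∀ B : ℝ, (∀ x ∈ K, ∀ i ≤ j, ‖iteratedFDeriv ℝ i f x‖ ≤ B) → ‖S f‖ ≤ C * B

/-- A net of distributions on `Ω` defining a *basic* functional on `G_c(Ω)`: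
for every compact `K ⊆ Ω` there are `j`, `N`, `η ∈ (0,1]` with
`|T_ε(f)| ≤ ε^{-N} sup_{x∈K,|α|≤j} |∂^α f(x)|` for all smooth `f` supported in `K`
and all `ε ≤ η`. -/
def IsBasicNetC {n : ℕ} (Ω : Set (Rn n)) (T : ℝ → (Rn n → ℂ) →ₗ[ℂ] ℂ) : Prop :=
  (∀ ε ∈ Ioc (0:ℝ) 1, IsDistributionOn Ω (T ε)) ∧
  ∀ K : Set (Rn n), IsCompact K → K ⊆ Ω →
    ∃ j N : ℕ, ∃ η ∈ Ioc (0:ℝ) 1, ∀ ε ∈ Ioc (0:ℝ) η,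
      ∀ f : Rn n → ℂ, ContDiffOn ℝ (⊤ : ℕ∞) f Ω → tsupport f ⊆ K →
        ∀ C : ℝ, 0 ≤ C → (∀ x ∈ K, ∀ i ≤ j, ‖iteratedFDeriv ℝ i f x‖ ≤ C) →
          ‖T ε f‖ ≤ ε ^ (-(N:ℝ)) * C

/-- A net of compactly supported distributions on `Ω` defining a *basic* functional on
`G(Ω)`: there are a compact `K ⊆ Ω` and `j`, `N`, `η ∈ (0,1]` with
`|T_ε(f)| ≤ ε^{-N} sup_{x∈K,|α|≤j} |∂^α f(x)|` for all `f ∈ C^∞(Ω)` and all `ε ≤ η`. -/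
def IsBasicNetE {n : ℕ} (Ω : Set (Rn n)) (T : ℝ → (Rn n → ℂ) →ₗ[ℂ] ℂ) : Prop :=
  (∀ ε ∈ Ioc (0:ℝ) 1, IsCptSuppDistributionOn Ω (T ε)) ∧
  ∃ K : Set (Rn n), IsCompact K ∧ K ⊆ Ω ∧
    ∃ j N : ℕ, ∃ η ∈ Ioc (0:ℝ) 1, ∀ ε ∈ Ioc (0:ℝ) η,
      ∀ f : Rn n → ℂ, ContDiffOn ℝ (⊤ : ℕ∞) f Ω →
        ∀ C : ℝ, 0 ≤ C → (∀ x ∈ K, ∀ i ≤ j, ‖iteratedFDeriv ℝ i f x‖ ≤ C) →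
          ‖T ε f‖ ≤ ε ^ (-(N:ℝ)) * C

end Colombeau

namespace Colombeau

/-- `f` is a Schwartz function: smooth and rapidly decreasing with all derivatives. -/
def IsSchwartzFn {E : Type} [NormedAddCommGroup E] [NormedSpace ℝ E] (f : E → ℂ) : Prop :=
  ContDiff ℝ (⊤ : ℕ∞) f ∧ ∀ h i : ℕ, ∃ C : ℝ, ∀ x, (1 + ‖x‖) ^ h * ‖iteratedFDeriv ℝ i f x‖ ≤ C

/-- `f` is slowly increasing together with all its derivatives (`f ∈ O_M`). -/
def IsSlowlyIncreasingFn {E : Type} [NormedAddCommGroup E] [NormedSpace ℝ E] (f : E → ℂ) : Prop :=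
  ContDiff ℝ (⊤ : ℕ∞) f ∧
    ∀ i : ℕ, ∃ C : ℝ, ∃ M : ℕ, ∀ x, ‖iteratedFDeriv ℝ i f x‖ ≤ C * (1 + ‖x‖) ^ M

/-- Moderate nets of Schwartz functions (representatives of elements of `G_S(ℝ^n)`):
for every `h` there is `N` with `p_h(u_ε) = O(ε^{-N})`, where
`p_h(f) = sup_{x, |α| ≤ h} (1+|x|)^h |∂^α f(x)|`. -/
def SchwartzModerate {E : Type} [NormedAddCommGroup E] [NormedSpace ℝ E] (u : ℝ → E → ℂ) : Prop :=
  (∀ ε ∈ Ioc (0:ℝ) 1, IsSchwartzFn (u ε)) ∧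
  ∀ h : ℕ, ∃ N : ℕ, ∃ c > 0, ∃ η ∈ Ioc (0:ℝ) 1, ∀ ε ∈ Ioc (0:ℝ) η, ∀ x, ∀ i ≤ h,
    (1 + ‖x‖) ^ h * ‖iteratedFDeriv ℝ i (u ε) x‖ ≤ c * ε ^ (-(N:ℝ))

/-- Negligible nets of Schwartz functions. -/
def SchwartzNegligible {E : Type} [NormedAddCommGroup E] [NormedSpace ℝ E] (u : ℝ → E → ℂ) : Prop :=
  (∀ ε ∈ Ioc (0:ℝ) 1, IsSchwartzFn (u ε)) ∧
  ∀ h : ℕ, ∀ q : ℕ, ∃ c > 0, ∃ η ∈ Ioc (0:ℝ) 1, ∀ ε ∈ Ioc (0:ℝ) η, ∀ x, ∀ i ≤ h,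
    (1 + ‖x‖) ^ h * ‖iteratedFDeriv ℝ i (u ε) x‖ ≤ c * ε ^ (q:ℝ)

/-- Regular moderate nets of Schwartz functions (representatives of `G_S^∞(ℝ^n)`):
one exponent `N` works for all seminorms. -/
def SchwartzGinfModerate {E : Type} [NormedAddCommGroup E] [NormedSpace ℝ E] (u : ℝ → E → ℂ) : Prop :=
  (∀ ε ∈ Ioc (0:ℝ) 1, IsSchwartzFn (u ε)) ∧
  ∃ N : ℕ, ∀ h : ℕ, ∃ c > 0, ∃ η ∈ Ioc (0:ℝ) 1, ∀ ε ∈ Ioc (0:ℝ) η, ∀ x, ∀ i ≤ h,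
    (1 + ‖x‖) ^ h * ‖iteratedFDeriv ℝ i (u ε) x‖ ≤ c * ε ^ (-(N:ℝ))

/-- `τ`-moderate nets (representatives of elements of `G_τ(ℝ^n)`):
for every derivative order `i` there is `N` with
`sup_x (1+|x|)^{-N} ‖∂^i u_ε(x)‖ = O(ε^{-N})`. -/
def TauModerate {E : Type} [NormedAddCommGroup E] [NormedSpace ℝ E] (u : ℝ → E → ℂ) : Prop :=
  (∀ ε ∈ Ioc (0:ℝ) 1, IsSlowlyIncreasingFn (u ε)) ∧
  ∀ i : ℕ, ∃ N : ℕ, ∃ c > 0, ∃ η ∈ Ioc (0:ℝ) 1, ∀ ε ∈ Ioc (0:ℝ) η, ∀ x,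
    ‖iteratedFDeriv ℝ i (u ε) x‖ ≤ c * (1 + ‖x‖) ^ N * ε ^ (-(N:ℝ))

/-- `τ`-negligible nets. -/
def TauNegligible {E : Type} [NormedAddCommGroup E] [NormedSpace ℝ E] (u : ℝ → E → ℂ) : Prop :=
  (∀ ε ∈ Ioc (0:ℝ) 1, IsSlowlyIncreasingFn (u ε)) ∧
  ∀ i : ℕ, ∃ N : ℕ, ∀ q : ℕ, ∃ c > 0, ∃ η ∈ Ioc (0:ℝ) 1, ∀ ε ∈ Ioc (0:ℝ) η, ∀ x,
    ‖iteratedFDeriv ℝ i (u ε) x‖ ≤ c * (1 + ‖x‖) ^ N * ε ^ (q:ℝ)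

/-- Regular `τ`-moderate nets (representatives of elements of `G_τ^∞(ℝ^n)`):
there is `N` such that for every `i` there is `M` with
`sup_x (1+|x|)^{-M} ‖∂^i u_ε(x)‖ = O(ε^{-N})`. -/
def TauGinfModerate {E : Type} [NormedAddCommGroup E] [NormedSpace ℝ E] (u : ℝ → E → ℂ) : Prop :=
  (∀ ε ∈ Ioc (0:ℝ) 1, IsSlowlyIncreasingFn (u ε)) ∧
  ∃ N : ℕ, ∀ i : ℕ, ∃ M : ℕ, ∃ c > 0, ∃ η ∈ Ioc (0:ℝ) 1, ∀ ε ∈ Ioc (0:ℝ) η, ∀ x,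
    ‖iteratedFDeriv ℝ i (u ε) x‖ ≤ c * (1 + ‖x‖) ^ M * ε ^ (-(N:ℝ))

/-- Norm of the mixed derivative `∂_x^a ∂_y^b u(x,y)`, encoded via iterated Fréchet
derivatives in each of the two variables. -/
def mixDeriv {E F : Type} [NormedAddCommGroup E] [NormedSpace ℝ E]
    [NormedAddCommGroup F] [NormedSpace ℝ F]
    (u : E × F → ℂ) (a b : ℕ) (x : E) (y : F) : ℝ :=
  ‖iteratedFDeriv ℝ a (fun x' => iteratedFDeriv ℝ b (fun y' => u (x', y')) y) x‖

/-- A net of tempered distributions defining a *basic* functional on `G_S(ℝ^n)`: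
there are `j`, `N`, `η ∈ (0,1]` with
`|T_ε(f)| ≤ ε^{-N} sup_{y, |β| ≤ j} (1+|y|)^j |∂^β f(y)|` for all Schwartz `f` and all
`ε ≤ η`. -/
def IsBasicNetS {n : ℕ} (T : ℝ → (Rn n → ℂ) →ₗ[ℂ] ℂ) : Prop :=
  (∀ ε ∈ Ioc (0:ℝ) 1, ∃ j : ℕ, ∃ C : ℝ, 0 ≤ C ∧
    ∀ f : Rn n → ℂ, ContDiff ℝ (⊤ : ℕ∞) f →
      ∀ B : ℝ, (∀ y, ∀ i ≤ j, (1 + ‖y‖) ^ j * ‖iteratedFDeriv ℝ i f y‖ ≤ B) →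
        ‖T ε f‖ ≤ C * B) ∧
  ∃ j N : ℕ, ∃ η ∈ Ioc (0:ℝ) 1, ∀ ε ∈ Ioc (0:ℝ) η,
    ∀ f : Rn n → ℂ, ContDiff ℝ (⊤ : ℕ∞) f →
      ∀ B : ℝ, 0 ≤ B → (∀ y, ∀ i ≤ j, (1 + ‖y‖) ^ j * ‖iteratedFDeriv ℝ i f y‖ ≤ B) →
        ‖T ε f‖ ≤ ε ^ (-(N:ℝ)) * B

/-- Condition (2.1) (`cond_A`) of the paper for a net on `ℝ^{2n}`:
for all `α ∈ ℕ^n` and `s ∈ ℕ` there is `N` with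
`sup_x (1+|x|)^{-N} sup_{y,|β|≤s} (1+|y|)^s |∂_x^α ∂_y^β u_ε(x,y)| = O(ε^{-N})`. -/
def CondA {n : ℕ} (u : ℝ → (Rn n × Rn n) → ℂ) : Prop :=
  ∀ a s : ℕ, ∃ N : ℕ, ∃ c > 0, ∃ η ∈ Ioc (0:ℝ) 1, ∀ ε ∈ Ioc (0:ℝ) η,
    ∀ x y : Rn n, ∀ b ≤ s,
      (1 + ‖y‖) ^ s * mixDeriv (u ε) a b x y ≤ c * (1 + ‖x‖) ^ N * ε ^ (-(N:ℝ))

/-- Condition (2.2) (`cond_B`) of the paper: as `CondA` but with an `ε`-exponent `M`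
independent of `α` and `s`. -/
def CondB {n : ℕ} (u : ℝ → (Rn n × Rn n) → ℂ) : Prop :=
  ∃ M : ℕ, ∀ a s : ℕ, ∃ N : ℕ, ∃ c > 0, ∃ η ∈ Ioc (0:ℝ) 1, ∀ ε ∈ Ioc (0:ℝ) η,
    ∀ x y : Rn n, ∀ b ≤ s,
      (1 + ‖y‖) ^ s * mixDeriv (u ε) a b x y ≤ c * (1 + ‖x‖) ^ N * ε ^ (-(M:ℝ))

end Colombeau

open Colombeau

namespace Colombeau

section Taylor

variable {E : Type} [NormedAddCommGroup E] [NormedSpace ℝ E]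

/-- The derivatives of the first-order Taylor remainder `w ↦ f (w + v) - f w - Df(w) v` are
quadratically small in `v`. -/
theorem norm_iteratedFDeriv_taylor_remainder_le (k : ℕ) :
    ∀ {G : Type} [NormedAddCommGroup G] [NormedSpace ℝ G] {f : E → G} {M : ℝ},
      ContDiff ℝ (⊤ : ℕ∞) f → (∀ z, ‖iteratedFDeriv ℝ (k + 2) f z‖ ≤ M) → ∀ v z : E,
      ‖iteratedFDeriv ℝ k (fun w => f (w + v) - f w - fderiv ℝ f w v) z‖ ≤ M * ‖v‖ ^ 2 := by
  induction k with
  | zero =>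
    intro G _ _ f M hf hM v z
    have hf1 : ContDiff ℝ (⊤ : ℕ∞) (fderiv ℝ f) := hf.fderiv_right (by simp)
    have h2 (w : E) : ‖fderiv ℝ (fderiv ℝ f) w‖ ≤ M := by
      rw [← norm_iteratedFDeriv_one, norm_iteratedFDeriv_fderiv]
      exact hM w
    have hM0 : 0 ≤ M := (norm_nonneg (fderiv ℝ (fderiv ℝ f) z)).trans (h2 z)
    have h1 (w : E) : ‖fderiv ℝ f w - fderiv ℝ f z‖ ≤ M * ‖w - z‖ :=
      convex_univ.norm_image_sub_le_of_norm_fderiv_le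
        (fun x _ => hf1.differentiable (by simp) x) (fun x _ => h2 x) (mem_univ _) (mem_univ _)
    have h0 := (convex_closedBall z ‖v‖).norm_image_sub_le_of_norm_fderiv_le' (𝕜 := ℝ)
      (f := f) (x := z) (y := z + v) (φ := fderiv ℝ f z) (C := M * ‖v‖)
      (fun x _ => hf.differentiable (by simp) x)
      (fun w hw => (h1 w).trans (mul_le_mul_of_nonneg_left (mem_closedBall_iff_norm.1 hw) hM0))
      (by simp) (by simp)
    rw [norm_iteratedFDeriv_zero]
    simpa [pow_two, mul_assoc] using h0
  | succ k ih =>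
    intro G _ _ f M hf hM v z
    have hf1 : ContDiff ℝ (⊤ : ℕ∞) (fderiv ℝ f) := hf.fderiv_right (by simp)
    have hd : Differentiable ℝ f := hf.differentiable (by simp)
    have hd1 : Differentiable ℝ (fderiv ℝ f) := hf1.differentiable (by simp)
    have hfd : fderiv ℝ (fun w => f (w + v) - f w - fderiv ℝ f w v) =
        fun w => fderiv ℝ f (w + v) - fderiv ℝ f w - fderiv ℝ (fderiv ℝ f) w v := by
      ext w h
      have hs : IsSymmSndFDerivAt ℝ f w := hf.contDiffAt.isSymmSndFDerivAt
        (by simpa using WithTop.coe_le_coe.2 (le_top : (2 : ℕ∞) ≤ ⊤))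
      have e1 : HasFDerivAt (fun w => f (w + v)) (fderiv ℝ f (w + v)) w :=
        by
        simpa using! (hd (w + v)).hasFDerivAt.comp w ((hasFDerivAt_id w).add_const v)
      have e2 : HasFDerivAt (fun w => fderiv ℝ f w v)
          ((fderiv ℝ (fderiv ℝ f) w).flip v) w := by
        simpa using (hd1 w).hasFDerivAt.clm_apply (hasFDerivAt_const v w)
      rw [((e1.fun_sub (hd w).hasFDerivAt).fun_sub e2).fderiv]
      simp [hs v h]
    rw [← norm_iteratedFDeriv_fderiv, hfd]
    exact ih hf1 (fun z => by rw [norm_iteratedFDeriv_fderiv]; exact hM z) v z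

theorem norm_iteratedFDeriv_comp_const_sub (k : ℕ) (f : E → ℂ) (x y : E) :
    ‖iteratedFDeriv ℝ k (fun y => f (x - y)) y‖ = ‖iteratedFDeriv ℝ k f (x - y)‖ := by
  have h := (LinearIsometryEquiv.neg ℝ (E := E)).norm_iteratedFDeriv_comp_right
    (fun y => f (x + y)) y k
  rw [iteratedFDeriv_comp_add_left] at h
  simpa [Function.comp_def, sub_eq_add_neg] using h

end Taylor

/-- `S` is bounded on smooth functions by `C` times the `C^j` seminorm over `K`. -/
def IsBoundedBySeminorm {n : ℕ} (S : (Rn n → ℂ) →ₗ[ℂ] ℂ) (K : Set (Rn n)) (j : ℕ) (C : ℝ) :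
    Prop :=
  ∀ f : Rn n → ℂ, ContDiff ℝ (⊤ : ℕ∞) f → ∀ B : ℝ, 0 ≤ B →
    (∀ x ∈ K, ∀ i ≤ j, ‖iteratedFDeriv ℝ i f x‖ ≤ B) → ‖S f‖ ≤ C * B

/-- All derivatives of `f` exist and are bounded. -/
def IsSmoothBounded {E : Type} [NormedAddCommGroup E] [NormedSpace ℝ E] (f : E → ℂ) : Prop :=
  ContDiff ℝ (⊤ : ℕ∞) f ∧ ∀ k : ℕ, ∃ M : ℝ, ∀ z, ‖iteratedFDeriv ℝ k f z‖ ≤ M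

theorem IsSchwartzFn.isSmoothBounded {E : Type} [NormedAddCommGroup E] [NormedSpace ℝ E]
    {f : E → ℂ} (hf : IsSchwartzFn f) : IsSmoothBounded f :=
  ⟨hf.1, fun k => by simpa using hf.2 0 k⟩

variable {n : ℕ}

/-- The `l`-th partial derivative. -/
def partialDeriv (l : Fin n) (f : Rn n → ℂ) : Rn n → ℂ :=
  fun x => fderiv ℝ f x (EuclideanSpace.single l 1)

/-- The convolution `x ↦ S (f (x - ·))`. -/
def convFunctional (S : (Rn n → ℂ) →ₗ[ℂ] ℂ) (f : Rn n → ℂ) : Rn n → ℂ :=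
  fun x => S fun y => f (x - y)

theorem contDiff_partialDeriv {f : Rn n → ℂ} (hf : ContDiff ℝ (⊤ : ℕ∞) f) (l : Fin n) :
    ContDiff ℝ (⊤ : ℕ∞) (partialDeriv l f) :=
  (hf.fderiv_right (m := (⊤ : ℕ∞)) (by simp)).clm_apply contDiff_const

theorem norm_iteratedFDeriv_partialDeriv_le {f : Rn n → ℂ} (hf : ContDiff ℝ (⊤ : ℕ∞) f)
    (l : Fin n) (k : ℕ) (x : Rn n) :
    ‖iteratedFDeriv ℝ k (partialDeriv l f) x‖ ≤ ‖iteratedFDeriv ℝ (k + 1) f x‖ := by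
  have h := norm_iteratedFDeriv_clm_apply_const (c := EuclideanSpace.single l (1 : ℝ)) (x := x)
    (hf.fderiv_right (m := (⊤ : ℕ∞)) (by simp)).contDiffAt
    (show (k : WithTop ℕ∞) ≤ (⊤ : ℕ∞) from mod_cast le_top)
  rw [norm_iteratedFDeriv_fderiv] at h
  simpa [Colombeau.partialDeriv] using! h

theorem IsSmoothBounded.partialDeriv {f : Rn n → ℂ} (hf : IsSmoothBounded f) (l : Fin n) :
    IsSmoothBounded (partialDeriv l f) :=
  ⟨contDiff_partialDeriv hf.1 l, fun k => (hf.2 (k + 1)).imp fun _ hM z =>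
    (norm_iteratedFDeriv_partialDeriv_le hf.1 l k z).trans (hM z)⟩

theorem fderiv_apply_eq_sum_partialDeriv (f : Rn n → ℂ) (x v : Rn n) :
    fderiv ℝ f x v = ∑ l, (v l : ℂ) * partialDeriv l f x := by
  conv_lhs => rw [← (EuclideanSpace.basisFun (Fin n) ℝ).sum_repr v]
  simp [partialDeriv]

/-- The map `c ↦ (v ↦ v l • c)`. -/
def coordSMulRight (l : Fin n) : ℂ →L[ℝ] Rn n →L[ℝ] ℂ :=
  ContinuousLinearMap.smulRightL ℝ (Rn n) ℂ (EuclideanSpace.proj l)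

theorem coordSMulRight_apply (l : Fin n) (c : ℂ) (v : Rn n) :
    coordSMulRight l c v = (v l : ℂ) * c := by
  simp [coordSMulRight]

variable {S : (Rn n → ℂ) →ₗ[ℂ] ℂ} {K : Set (Rn n)} {j : ℕ} {C : ℝ}

theorem IsBoundedBySeminorm.norm_convFunctional_sub_le (hS : IsBoundedBySeminorm S K j C)
    {f : Rn n → ℂ} (hf : IsSmoothBounded f) :
    ∃ M : ℝ, ∀ x v : Rn n,
      ‖convFunctional S f (x + v) - convFunctional S f x -
        (∑ l, coordSMulRight l (convFunctional S (partialDeriv l f) x)) v‖ ≤ M * ‖v‖ ^ 2 := by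
  choose M hM using hf.2
  have hM0 (k : ℕ) : 0 ≤ M k := (norm_nonneg _).trans (hM k 0)
  refine ⟨C * ∑ k ∈ Finset.range (j + 1), M (k + 2), fun x v => ?_⟩
  set F : Rn n → ℂ := fun w => f (w + v) - f w - fderiv ℝ f w v with hF
  have hFsmooth : ContDiff ℝ (⊤ : ℕ∞) F :=
    ((hf.1.comp (contDiff_id.add contDiff_const)).sub hf.1).sub
      ((hf.1.fderiv_right (m := (⊤ : ℕ∞)) (by simp)).clm_apply contDiff_const)
  have hSF : convFunctional S f (x + v) - convFunctional S f x -
      (∑ l, coordSMulRight l (convFunctional S (partialDeriv l f) x)) v =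
      S fun y => F (x - y) := by
    have hdecomp : (fun y => F (x - y)) = (fun y => f (x + v - y)) - (fun y => f (x - y)) -
        ∑ l, (v l : ℂ) • fun y => partialDeriv l f (x - y) := by
      ext y
      simp [hF, fderiv_apply_eq_sum_partialDeriv, sub_add_eq_add_sub]
    rw [hdecomp, map_sub, map_sub, map_sum]
    simp [convFunctional, coordSMulRight_apply]
  rw [hSF, mul_assoc]
  refine hS _ (hFsmooth.comp (contDiff_const.sub contDiff_id)) _
    (mul_nonneg (Finset.sum_nonneg fun k _ => hM0 _) (by positivity)) fun y _ i hi => ?_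
  refine (norm_iteratedFDeriv_comp_const_sub i F x y).trans_le ?_
  refine (norm_iteratedFDeriv_taylor_remainder_le i hf.1 (hM (i + 2)) v _).trans ?_
  gcongr
  exact Finset.single_le_sum (f := fun k => M (k + 2)) (fun k _ => hM0 _)
    (Finset.mem_range.2 (by omega))

theorem IsBoundedBySeminorm.hasFDerivAt_convFunctional (hS : IsBoundedBySeminorm S K j C)
    {f : Rn n → ℂ} (hf : IsSmoothBounded f) (x : Rn n) :
    HasFDerivAt (convFunctional S f)
      (∑ l, coordSMulRight l (convFunctional S (partialDeriv l f) x)) x := by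
  obtain ⟨M, hM⟩ := hS.norm_convFunctional_sub_le hf
  rw [hasFDerivAt_iff_isLittleO_nhds_zero]
  refine (Asymptotics.IsBigO.of_bound M (.of_forall fun v => ?_)).trans_isLittleO
    (Asymptotics.isLittleO_norm_pow_id one_lt_two)
  simpa using hM x v

theorem IsBoundedBySeminorm.fderiv_convFunctional (hS : IsBoundedBySeminorm S K j C)
    {f : Rn n → ℂ} (hf : IsSmoothBounded f) :
    fderiv ℝ (convFunctional S f) =
      fun x => ∑ l, (coordSMulRight l ∘ convFunctional S (partialDeriv l f)) x :=
  funext fun x => (hS.hasFDerivAt_convFunctional hf x).fderiv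

theorem IsBoundedBySeminorm.contDiff_convFunctional (hS : IsBoundedBySeminorm S K j C)
    {f : Rn n → ℂ} (hf : IsSmoothBounded f) :
    ContDiff ℝ (⊤ : ℕ∞) (convFunctional S f) := by
  refine contDiff_infty.2 fun m => ?_
  induction m generalizing f with
  | zero =>
    exact contDiff_zero.2 (continuous_iff_continuousAt.2 fun x =>
      (hS.hasFDerivAt_convFunctional hf x).continuousAt)
  | succ m ih =>
    push_cast
    refine contDiff_succ_iff_fderiv.2
      ⟨fun x => (hS.hasFDerivAt_convFunctional hf x).differentiableAt, fun h => absurd h (by simp), ?_⟩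
    rw [hS.fderiv_convFunctional hf]
    exact ContDiff.sum fun l _ => (coordSMulRight l).contDiff.comp (ih (hf.partialDeriv l))

theorem IsBoundedBySeminorm.norm_iteratedFDeriv_convFunctional_le
    (hS : IsBoundedBySeminorm S K j C) (i : ℕ) {f : Rn n → ℂ} (hf : IsSmoothBounded f)
    {x : Rn n} {B : ℝ} (hB : 0 ≤ B)
    (hfB : ∀ y ∈ K, ∀ k ≤ i + j, ‖iteratedFDeriv ℝ k f (x - y)‖ ≤ B) :
    ‖iteratedFDeriv ℝ i (convFunctional S f) x‖ ≤
      (∑ l : Fin n, ‖coordSMulRight l‖) ^ i * (C * B) := by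
  induction i generalizing f with
  | zero =>
    rw [norm_iteratedFDeriv_zero, pow_zero, one_mul]
    refine hS _ (hf.1.comp (contDiff_const.sub contDiff_id)) B hB fun y hy k hk => ?_
    exact (norm_iteratedFDeriv_comp_const_sub k f x y).trans_le (hfB y hy k (by omega))
  | succ i ih =>
    have hsmooth (l : Fin n) : ContDiff ℝ (⊤ : ℕ∞) (convFunctional S (partialDeriv l f)) :=
      hS.contDiff_convFunctional (hf.partialDeriv l)
    have hi : (i : WithTop ℕ∞) ≤ (⊤ : ℕ∞) := mod_cast le_top
    rw [← norm_iteratedFDeriv_fderiv, hS.fderiv_convFunctional hf,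
      iteratedFDeriv_fun_sum_apply fun l _ =>
        ((coordSMulRight l).contDiff.comp ((hsmooth l).of_le hi)).contDiffAt,
      pow_succ', mul_assoc, Finset.sum_mul]
    refine norm_sum_le_of_le _ fun l _ =>
      ((coordSMulRight l).norm_iteratedFDeriv_comp_left (hsmooth l).contDiffAt hi).trans ?_
    gcongr
    exact ih (hf.partialDeriv l) fun y hy k hk =>
      (norm_iteratedFDeriv_partialDeriv_le hf.1 l k _).trans (hfB y hy (k + 1) (by omega))

theorem IsBoundedBySeminorm.weighted_norm_iteratedFDeriv_convFunctional_le
    (hS : IsBoundedBySeminorm S K j C) {R : ℝ} (hR : 0 ≤ R) (hK : ∀ y ∈ K, ‖y‖ ≤ R)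
    {f : Rn n → ℂ} (hf : IsSmoothBounded f) {h i : ℕ} {P : ℝ} (hP : 0 ≤ P)
    (hfP : ∀ z, ∀ k ≤ i + j, (1 + ‖z‖) ^ h * ‖iteratedFDeriv ℝ k f z‖ ≤ P) (x : Rn n) :
    (1 + ‖x‖) ^ h * ‖iteratedFDeriv ℝ i (convFunctional S f) x‖ ≤
      (∑ l : Fin n, ‖coordSMulRight l‖) ^ i * (C * ((1 + R) ^ h * P)) := by
  have hx : 0 < (1 + ‖x‖) ^ h := by positivity
  have key := hS.norm_iteratedFDeriv_convFunctional_le i hf (x := x)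
    (B := (1 + R) ^ h * P / (1 + ‖x‖) ^ h) (by positivity) fun y hy k hk => by
      rw [le_div_iff₀' hx]
      have hxy : 1 + ‖x‖ ≤ (1 + R) * (1 + ‖x - y‖) := by
        have h1 : ‖x‖ ≤ ‖x - y‖ + ‖y‖ := by simpa using norm_add_le (x - y) y
        nlinarith [hK y hy, mul_nonneg hR (norm_nonneg (x - y))]
      calc (1 + ‖x‖) ^ h * ‖iteratedFDeriv ℝ k f (x - y)‖
          ≤ ((1 + R) * (1 + ‖x - y‖)) ^ h * ‖iteratedFDeriv ℝ k f (x - y)‖ := by gcongr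
        _ = (1 + R) ^ h * ((1 + ‖x - y‖) ^ h * ‖iteratedFDeriv ℝ k f (x - y)‖) := by
          rw [mul_pow, mul_assoc]
        _ ≤ (1 + R) ^ h * P := by gcongr; exact hfP _ k hk
  calc (1 + ‖x‖) ^ h * ‖iteratedFDeriv ℝ i (convFunctional S f) x‖
      ≤ (1 + ‖x‖) ^ h * ((∑ l : Fin n, ‖coordSMulRight l‖) ^ i *
          (C * ((1 + R) ^ h * P / (1 + ‖x‖) ^ h))) := by gcongr
    _ = _ := by field_simp

theorem IsBoundedBySeminorm.isSchwartzFn_convFunctional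
    (hS : IsBoundedBySeminorm S K j C) (hK : IsCompact K) {f : Rn n → ℂ} (hf : IsSchwartzFn f) :
    IsSchwartzFn (convFunctional S f) := by
  obtain ⟨R, hR, hKR⟩ := hK.isBounded.exists_pos_norm_le
  refine ⟨hS.contDiff_convFunctional hf.isSmoothBounded, fun h i => ?_⟩
  choose P hP using hf.2 h
  have hP0 (k : ℕ) : 0 ≤ P k := le_trans (by positivity) (hP k 0)
  exact ⟨_, hS.weighted_norm_iteratedFDeriv_convFunctional_le hR.le hKR hf.isSmoothBounded
    (P := ∑ k ∈ Finset.range (i + j + 1), P k) (Finset.sum_nonneg fun k _ => hP0 k)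
    fun z k hk => (hP k z).trans (Finset.single_le_sum (fun k _ => hP0 k)
      (Finset.mem_range.2 (by omega)))⟩

end Colombeau

/-- If `T` is a basic functional in `L(G(ℝ^n),ℂ̃)`, defined by a net
`(T_ε)` of compactly supported distributions, and `u ∈ G_S(ℝ^n)`, then the convolution
`u ∗ T` defined by `(u∗T)(x) := T(u(x−·))`, i.e. with representative
`x ↦ T_ε(u_ε(x−·))`, belongs to `G_S(ℝ^n)`: the net `(T_ε(u_ε(x−·)))_ε` is a moderate
net of Schwartz functions. -/
theorem statement6
    {n : ℕ}
    (T : ℝ → (Rn n → ℂ) →ₗ[ℂ] ℂ) (hT : IsBasicNetE (univ : Set (Rn n)) T)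
    (u : ℝ → Rn n → ℂ) (hu : SchwartzModerate u) :
    SchwartzModerate (fun ε x => T ε (fun y => u ε (x - y))) := by
  refine ⟨fun ε hε => ?_, fun h => ?_⟩
  · obtain ⟨K, hK, -, j, C, -, hS⟩ := hT.1 ε hε
    have hS' : IsBoundedBySeminorm (T ε) K j C := fun f hf B _ hB =>
      hS f (contDiffOn_univ.2 hf) B hB
    exact hS'.isSchwartzFn_convFunctional hK (hu.1 ε hε)
  · obtain ⟨K, hK, -, j, N, η, hη, hS⟩ := hT.2
    obtain ⟨N', c, hc, η', hη', hP⟩ := hu.2 (h + j)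
    obtain ⟨R, hR, hKR⟩ := hK.isBounded.exists_pos_norm_le
    set A : ℝ := ∑ l : Fin n, ‖coordSMulRight l‖
    have hA : 0 ≤ A := Finset.sum_nonneg fun l _ => norm_nonneg (coordSMulRight l)
    refine ⟨N + N', (1 + A) ^ h * ((1 + R) ^ h * c), by positivity, min η η',
      ⟨lt_min hη.1 hη'.1, (min_le_left _ _).trans hη.2⟩, fun ε hε x i hi => ?_⟩
    have hε0 : 0 < ε := hε.1
    have hεη : ε ∈ Ioc 0 η := ⟨hε0, hε.2.trans (min_le_left _ _)⟩
    have hεη' : ε ∈ Ioc 0 η' := ⟨hε0, hε.2.trans (min_le_right _ _)⟩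
    have hS' : IsBoundedBySeminorm (T ε) K j (ε ^ (-(N:ℝ))) := fun f hf B hB0 hB =>
      hS ε hεη f (contDiffOn_univ.2 hf) B hB0 hB
    have key := hS'.weighted_norm_iteratedFDeriv_convFunctional_le hR.le hKR
      (hu.1 ε ⟨hε0, hεη.2.trans hη.2⟩).isSmoothBounded (h := h) (i := i)
      (P := c * ε ^ (-(N':ℝ))) (by positivity)
      (fun z k hk => le_trans
        (mul_le_mul_of_nonneg_right (pow_le_pow_right₀ (by simp) (Nat.le_add_right h j))
          (norm_nonneg _)) (hP ε hεη' z k (by omega))) x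
    have hAi : A ^ i ≤ (1 + A) ^ h :=
      (pow_le_pow_left₀ hA (by linarith) i).trans (pow_le_pow_right₀ (by linarith) hi)
    have hpow : ε ^ (-((N + N' : ℕ):ℝ)) = ε ^ (-(N:ℝ)) * ε ^ (-(N':ℝ)) := by
      rw [← Real.rpow_add hε0]
      push_cast
      ring_nf
    rw [hpow]
    refine key.trans ((mul_le_mul_of_nonneg_right hAi (by positivity)).trans_eq ?_)
    ring
end
end

section
/- Let S ∈ L(G(ℝ^n),ℂ̃), regarded as a compactly supported functional in L(G_c(ℝ^n),ℂ̃), and let T be a basic functional in L(G_c(ℝ^n),ℂ̃). Define the convolution S∗T ∈ L(G_c(ℝ^n),ℂ̃) by (S∗T)(u) = S_x(T_y(u(x+y))). Then supp(S∗T) ⊆ supp S + supp T. -/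
noncomputable section

open Set MeasureTheory Topology

open Pointwise

namespace Colombeau

/-- The support of a functional given at the level of nets: the complement of the union
of the open sets `W` such that the functional vanishes on every compactly supported
(moderate) net with support in a compact subset of `W`. -/
def suppFunctional {n : ℕ} (S : (ℝ → Rn n → ℂ) → ℝ → ℂ) : Set (Rn n) :=
  {x | ¬ ∃ W : Set (Rn n), IsOpen W ∧ x ∈ W ∧
    ∀ u : ℝ → Rn n → ℂ, IsModerate (univ : Set (Rn n)) u →
      (∃ K : Set (Rn n), IsCompact K ∧ K ⊆ W ∧ ∀ ε ∈ Ioc (0:ℝ) 1, tsupport (u ε) ⊆ K) →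
      CIsNegligible (S u)}

end Colombeau

open Colombeau

namespace Colombeau

open scoped ContDiff

lemma exists_bound_uniform {α : Type*} {b : ℝ} {K : Set α} {g : ℕ → ℝ → α → ℝ} {j : ℕ}
    (h : ∀ k ≤ j, ∃ c > 0, ∃ η ∈ Ioc (0:ℝ) 1, ∀ ε ∈ Ioc (0:ℝ) η, ∀ x ∈ K, g k ε x ≤ c * ε ^ b) :
    ∃ c > 0, ∃ η ∈ Ioc (0:ℝ) 1, ∀ ε ∈ Ioc (0:ℝ) η, ∀ x ∈ K, ∀ k ≤ j, g k ε x ≤ c * ε ^ b := by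
  induction j with
  | zero =>
    obtain ⟨c, hc, η, hη, H⟩ := h 0 le_rfl
    refine ⟨c, hc, η, hη, fun ε hε x hx k hk => ?_⟩
    obtain rfl : k = 0 := by omega
    exact H ε hε x hx
  | succ j ih =>
    obtain ⟨c, hc, η, hη, H⟩ := ih fun k hk => h k (by omega)
    obtain ⟨c', hc', η', hη', H'⟩ := h (j + 1) le_rfl
    refine ⟨max c c', lt_max_of_lt_left hc, min η η', ⟨lt_min hη.1 hη'.1, min_le_of_left_le hη.2⟩,
      fun ε hε x hx k hk => ?_⟩
    have hb : 0 ≤ ε ^ b := Real.rpow_nonneg hε.1.le b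
    rcases Nat.lt_or_ge j k with hk' | hk'
    · obtain rfl : k = j + 1 := by omega
      exact (H' ε ⟨hε.1, hε.2.trans (min_le_right _ _)⟩ x hx).trans
        (mul_le_mul_of_nonneg_right (le_max_right _ _) hb)
    · exact (H ε ⟨hε.1, hε.2.trans (min_le_left _ _)⟩ x hx k hk').trans
        (mul_le_mul_of_nonneg_right (le_max_left _ _) hb)

lemma mul_rpow_le_mul_rpow {b b' c ε : ℝ} (hc : 0 < c) (hε : ε ∈ Ioc (0:ℝ) 1) (h : b' ≤ b) :
    c * ε ^ b ≤ c * ε ^ b' :=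
  mul_le_mul_of_nonneg_left (Real.rpow_le_rpow_of_exponent_ge hε.1 hε.2 h) hc.le

lemma exists_moderate_bound_uniform {α : Type*} {K : Set α} {g : ℕ → ℝ → α → ℝ} {j : ℕ}
    (h : ∀ k ≤ j, ∃ N : ℕ, ∃ c > 0, ∃ η ∈ Ioc (0:ℝ) 1, ∀ ε ∈ Ioc (0:ℝ) η, ∀ x ∈ K,
      g k ε x ≤ c * ε ^ (-(N:ℝ))) :
    ∃ N : ℕ, ∃ c > 0, ∃ η ∈ Ioc (0:ℝ) 1, ∀ ε ∈ Ioc (0:ℝ) η, ∀ x ∈ K, ∀ k ≤ j,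
      g k ε x ≤ c * ε ^ (-(N:ℝ)) := by
  have h' : ∀ k, ∃ N : ℕ, k ≤ j → ∃ c > 0, ∃ η ∈ Ioc (0:ℝ) 1, ∀ ε ∈ Ioc (0:ℝ) η, ∀ x ∈ K,
      g k ε x ≤ c * ε ^ (-(N:ℝ)) := by
    intro k
    by_cases hk : k ≤ j
    · exact (h k hk).imp fun N hN _ => hN
    · exact ⟨0, fun h => absurd h hk⟩
  choose N hN using h'
  refine ⟨(Finset.range (j + 1)).sup N, exists_bound_uniform fun k hk => ?_⟩
  obtain ⟨c, hc, η, hη, H⟩ := hN k hk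
  refine ⟨c, hc, η, hη, fun ε hε x hx => (H ε hε x hx).trans ?_⟩
  refine mul_rpow_le_mul_rpow hc ⟨hε.1, hε.2.trans hη.2⟩ ?_
  have : N k ≤ (Finset.range (j + 1)).sup N :=
    Finset.le_sup (f := N) (Finset.mem_range.2 (by omega))
  exact neg_le_neg (by exact_mod_cast this)

section Calculus

variable {E F : Type} [NormedAddCommGroup E] [NormedSpace ℝ E]
  [NormedAddCommGroup F] [NormedSpace ℝ F]

lemma iteratedFDeriv_succ_apply_fderiv {f : E → F} (hf : ContDiff ℝ ∞ f) (i : ℕ) (x : E)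
    (m : Fin (i + 1) → E) :
    iteratedFDeriv ℝ (i + 1) f x m =
      iteratedFDeriv ℝ i (fun y => fderiv ℝ f y (m (Fin.last i))) x (Fin.init m) := by
  rw [iteratedFDeriv_succ_apply_right]
  have := (ContinuousLinearMap.apply ℝ F (m (Fin.last i))).iteratedFDeriv_comp_left (x := x)
    (n := ∞) (i := i) (hf.fderiv_right (m := ∞) (by simp)).contDiffAt (by exact_mod_cast le_top)
  have h2 : (⇑(ContinuousLinearMap.apply ℝ F (m (Fin.last i))) ∘ fderiv ℝ f) =
    fun y => fderiv ℝ f y (m (Fin.last i)) := rfl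
  rw [h2] at this
  rw [this]
  rfl

lemma contDiff_fderiv_apply {f : E → F} (hf : ContDiff ℝ ∞ f) (h : E) :
    ContDiff ℝ ∞ fun y => fderiv ℝ f y h :=
  (hf.fderiv_right (m := ∞) (by simp)).clm_apply contDiff_const

lemma norm_iteratedFDeriv_fderiv_apply_le {f : E → F} (hf : ContDiff ℝ ∞ f) (h : E) (l : ℕ)
    (y : E) :
    ‖iteratedFDeriv ℝ l (fun y => fderiv ℝ f y h) y‖ ≤ ‖h‖ * ‖iteratedFDeriv ℝ (l + 1) f y‖ := by
  rw [← norm_iteratedFDeriv_fderiv]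
  exact norm_iteratedFDeriv_clm_apply_const (N := ∞)
    (hf.fderiv_right (m := ∞) (by simp)).contDiffAt (by exact_mod_cast le_top)

lemma contDiff_iteratedFDeriv_apply {f : E → F} (hf : ContDiff ℝ ∞ f) (i : ℕ) (m : Fin i → E) :
    ContDiff ℝ ∞ fun y => iteratedFDeriv ℝ i f y m :=
  (ContinuousMultilinearMap.apply ℝ (fun _ : Fin i => E) F m).contDiff.comp
    (hf.iteratedFDeriv_right (m := ∞) (i := i) (by exact_mod_cast le_top))

lemma tsupport_iteratedFDeriv_apply_subset (f : E → F) (i : ℕ) (m : Fin i → E) :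
    tsupport (fun y => iteratedFDeriv ℝ i f y m) ⊆ tsupport f := by
  refine (closure_mono fun y hy => ?_).trans (tsupport_iteratedFDeriv_subset (𝕜 := ℝ) i)
  simp only [Function.mem_support] at hy ⊢
  rintro h
  exact hy (by simp [h])

lemma norm_iteratedFDeriv_iteratedFDeriv_apply_le {f : E → F} (hf : ContDiff ℝ ∞ f) (l i : ℕ)
    (m : Fin i → E) (y : E) :
    ‖iteratedFDeriv ℝ l (fun y => iteratedFDeriv ℝ i f y m) y‖ ≤
      (∏ k, ‖m k‖) * ‖iteratedFDeriv ℝ (l + i) f y‖ := by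
  induction i generalizing f with
  | zero => simp
  | succ i ih =>
    simp_rw [iteratedFDeriv_succ_apply_fderiv hf]
    refine (ih (contDiff_fderiv_apply hf _) (Fin.init m)).trans ?_
    rw [Fin.prod_univ_castSucc, mul_assoc]
    exact mul_le_mul_of_nonneg_left (norm_iteratedFDeriv_fderiv_apply_le hf _ _ _) (by positivity)

lemma exists_norm_fderiv_le {f : E → F} (hf : ContDiff ℝ ∞ f) (hc : HasCompactSupport f) :
    ∃ C, ∀ x, ‖fderiv ℝ f x‖ ≤ C :=
  (hf.continuous_fderiv (by simp)).bounded_above_of_compact_support (hc.fderiv ℝ)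

/-- The first order Taylor remainder of a test function is `O(‖h‖²)` together with all its
derivatives. -/
lemma exists_norm_iteratedFDeriv_taylor_le (i : ℕ) {f : E → F} (hf : ContDiff ℝ ∞ f)
    (hc : HasCompactSupport f) :
    ∃ C, 0 ≤ C ∧ ∀ h y, ‖iteratedFDeriv ℝ i (fun y => f (y + h) - f y - fderiv ℝ f y h) y‖ ≤
      C * ‖h‖ ^ 2 := by
  induction i generalizing F with
  | zero =>
    have hf1 : ContDiff ℝ ∞ (fderiv ℝ f) := hf.fderiv_right (by simp)
    obtain ⟨C, hC⟩ := exists_norm_fderiv_le hf1 (hc.fderiv ℝ)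
    have hC0 : 0 ≤ C := (norm_nonneg _).trans (hC 0)
    refine ⟨C, hC0, fun h y => ?_⟩
    rw [norm_iteratedFDeriv_zero]
    have key := (convex_closedBall y ‖h‖).norm_image_sub_le_of_norm_fderiv_le' (𝕜 := ℝ) (f := f)
      (φ := fderiv ℝ f y) (C := C * ‖h‖) (x := y) (y := y + h)
      (fun x _ => (hf.differentiable (by simp)).differentiableAt) (fun x hx => ?_)
      (by simp) (by simp)
    · simpa [pow_two, mul_assoc] using key
    · refine (convex_univ.norm_image_sub_le_of_norm_fderiv_le (𝕜 := ℝ) (f := fderiv ℝ f)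
        (C := C) (fun x _ => (hf1.differentiable (by simp)).differentiableAt) (fun x _ => hC x)
        (mem_univ y) (mem_univ x)).trans ?_
      exact mul_le_mul_of_nonneg_left (by simpa [dist_eq_norm] using hx) hC0
  | succ i ih =>
    have hf1 : ContDiff ℝ ∞ (fderiv ℝ f) := hf.fderiv_right (by simp)
    obtain ⟨C, hC0, hC⟩ := ih hf1 (hc.fderiv ℝ)
    refine ⟨C, hC0, fun h y => ?_⟩
    have hd : Differentiable ℝ f := hf.differentiable (by simp)
    have hd1 : Differentiable ℝ (fderiv ℝ f) := hf1.differentiable (by simp)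
    have : fderiv ℝ (fun y => f (y + h) - f y - fderiv ℝ f y h) =
        fun y => fderiv ℝ f (y + h) - fderiv ℝ f y - fderiv ℝ (fderiv ℝ f) y h := by
      funext z
      have h1 : HasFDerivAt (fun y => f (y + h)) (fderiv ℝ f (z + h)) z :=
        (hasFDerivAt_comp_add_right h).2 (hd _).hasFDerivAt
      have h2 := (hd1 z).hasFDerivAt.clm_apply (hasFDerivAt_const h z)
      refine ((h1.sub (hd z).hasFDerivAt).sub h2).fderiv.trans ?_
      ext k
      have := second_derivative_symmetric (f := f) (f' := fderiv ℝ f)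
        (f'' := fderiv ℝ (fderiv ℝ f) z) (x := z) (fun y => (hd y).hasFDerivAt)
        (hd1 z).hasFDerivAt h k
      simp [this]
    rw [← norm_iteratedFDeriv_fderiv, this]
    exact hC h y

end Calculus

section Distribution

variable {n : ℕ}

lemma tsupport_comp_const_add_subset {E F : Type*} [NormedAddCommGroup E] [Zero F] (f : E → F)
    (x : E) {K : Set E} (hf : tsupport f ⊆ K) :
    tsupport (fun y => f (x + y)) ⊆ (fun y => x + y) ⁻¹' K := by
  refine Subset.trans ?_ (preimage_mono hf)
  refine closure_minimal (fun y hy => subset_tsupport f hy) ?_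
  exact (isClosed_tsupport f).preimage (by fun_prop)

lemma IsDistributionOn.hasFDerivAt_apply_comp_add {T : (Rn n → ℂ) →ₗ[ℂ] ℂ}
    (hT : IsDistributionOn univ T) {f : Rn n → ℂ} (hf : ContDiff ℝ ∞ f)
    (hc : HasCompactSupport f) (x : Rn n) :
    ∃ L : Rn n →L[ℝ] ℂ, HasFDerivAt (fun x => T fun y => f (x + y)) L x ∧
      ∀ h, L h = T fun y => fderiv ℝ f (x + y) h := by
  let L : Rn n →ₗ[ℝ] ℂ :=
    { toFun := fun h => T fun y => fderiv ℝ f (x + y) h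
      map_add' := fun h k => by
        rw [← map_add]
        congr 1
        ext y
        simp
      map_smul' := fun c h => by
        have : (fun y => fderiv ℝ f (x + y) (c • h)) =
            (c : ℂ) • fun y => fderiv ℝ f (x + y) h := by
          ext y
          simp
        rw [this, map_smul]
        simp }
  refine ⟨L.toContinuousLinearMap, ?_, fun h => rfl⟩
  set K : Set (Rn n) := tsupport f + Metric.closedBall 0 (‖x‖ + 1)
  have hK : IsCompact K := hc.isCompact.add (isCompact_closedBall _ _)
  obtain ⟨j, C, hC, hTK⟩ := hT K hK (subset_univ _)
  choose D hD0 hD using fun i => exists_norm_iteratedFDeriv_taylor_le i hf hc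
  let B := ∑ i ∈ Finset.range (j + 1), D i
  have hrem : ∀ h : Rn n, ‖h‖ ≤ 1 → ‖T (fun y => f (x + h + y)) - T (fun y => f (x + y)) -
      T (fun y => fderiv ℝ f (x + y) h)‖ ≤ C * B * ‖h‖ ^ 2 := by
    intro h hh
    set R : Rn n → ℂ := fun y => f (y + h) - f y - fderiv ℝ f y h with hR
    have hRs : ContDiff ℝ ∞ R :=
      ((hf.comp (contDiff_id.add contDiff_const)).sub hf).sub (contDiff_fderiv_apply hf h)
    have hTR : T (fun y => f (x + h + y)) - T (fun y => f (x + y)) -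
        T (fun y => fderiv ℝ f (x + y) h) = T fun y => R (x + y) := by
      rw [← map_sub, ← map_sub]
      congr 1
      ext y
      simp [hR, add_right_comm]
    rw [hTR, mul_assoc]
    have hRs' : ContDiff ℝ ∞ fun y => R (x + y) := hRs.comp (contDiff_const.add contDiff_id)
    refine hTK _ hRs'.contDiffOn ?_ _ ?_
    · refine closure_minimal (fun y hy => ?_) hK.isClosed
      by_contra hyK
      have hz : ∀ k : Rn n, ‖k‖ ≤ 1 → x + y + k ∉ tsupport f := by
        intro k hk hmem
        refine hyK ⟨x + y + k, hmem, -(x + k), ?_, by simp⟩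
        rw [mem_closedBall_zero_iff, norm_neg]
        exact (norm_add_le x k).trans (by gcongr)
      have h0 : x + y ∉ tsupport f := by simpa using hz 0 (by simp)
      refine hy ?_
      have h1 : f (x + y + h) = 0 := image_eq_zero_of_notMem_tsupport (hz h hh)
      have h2 : f (x + y) = 0 := image_eq_zero_of_notMem_tsupport h0
      have h3 : fderiv ℝ f (x + y) = 0 :=
        image_eq_zero_of_notMem_tsupport fun hm => h0 (tsupport_fderiv_subset ℝ hm)
      simp [hR, h1, h2, h3]
    · intro y _ i hi
      rw [iteratedFDeriv_comp_add_left]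
      refine (hD i h (x + y)).trans (mul_le_mul_of_nonneg_right ?_ (by positivity))
      exact Finset.single_le_sum (f := D) (fun i _ => hD0 i) (Finset.mem_range.2 (by omega))
  rw [hasFDerivAt_iff_isLittleO_nhds_zero]
  refine (Asymptotics.IsBigO.of_bound (C * B) ?_).trans_isLittleO
    (Asymptotics.isLittleO_norm_pow_id one_lt_two)
  filter_upwards [Metric.closedBall_mem_nhds (0 : Rn n) one_pos] with h hh
  simpa [L] using hrem h (by simpa using hh)

lemma IsDistributionOn.fderiv_apply_comp_add {T : (Rn n → ℂ) →ₗ[ℂ] ℂ}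
    (hT : IsDistributionOn univ T) {f : Rn n → ℂ} (hf : ContDiff ℝ ∞ f)
    (hc : HasCompactSupport f) (x h : Rn n) :
    fderiv ℝ (fun x => T fun y => f (x + y)) x h = T fun y => fderiv ℝ f (x + y) h := by
  obtain ⟨L, hL, hLh⟩ := hT.hasFDerivAt_apply_comp_add hf hc x
  rw [hL.fderiv, hLh]

lemma hasCompactSupport_fderiv_apply {f : Rn n → ℂ} (hc : HasCompactSupport f) (h : Rn n) :
    HasCompactSupport fun y => fderiv ℝ f y h :=
  hc.of_isClosed_subset isClosed_closure (tsupport_fderiv_apply_subset ℝ h)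

lemma IsDistributionOn.contDiff_apply_comp_add {T : (Rn n → ℂ) →ₗ[ℂ] ℂ}
    (hT : IsDistributionOn univ T) {f : Rn n → ℂ} (hf : ContDiff ℝ ∞ f)
    (hc : HasCompactSupport f) :
    ContDiff ℝ ∞ fun x => T fun y => f (x + y) := by
  rw [contDiff_infty]
  intro k
  induction k generalizing f with
  | zero =>
    refine contDiff_zero.2 (Differentiable.continuous (𝕜 := ℝ) fun x => ?_)
    obtain ⟨L, hL, -⟩ := hT.hasFDerivAt_apply_comp_add hf hc x
    exact hL.differentiableAt
  | succ k ih =>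
    push_cast
    refine contDiff_succ_iff_fderiv_apply.2 ⟨fun x => ?_, fun h => ?_, fun h => ?_⟩
    · obtain ⟨L, hL, -⟩ := hT.hasFDerivAt_apply_comp_add hf hc x
      exact hL.differentiableAt
    · simp at h
    · simp_rw [hT.fderiv_apply_comp_add hf hc]
      exact ih (contDiff_fderiv_apply hf h) (hasCompactSupport_fderiv_apply hc h)

lemma IsDistributionOn.iteratedFDeriv_apply_comp_add {T : (Rn n → ℂ) →ₗ[ℂ] ℂ}
    (hT : IsDistributionOn univ T) {f : Rn n → ℂ} (hf : ContDiff ℝ ∞ f)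
    (hc : HasCompactSupport f) (i : ℕ) (x : Rn n) (m : Fin i → Rn n) :
    iteratedFDeriv ℝ i (fun x => T fun y => f (x + y)) x m =
      T fun y => iteratedFDeriv ℝ i f (x + y) m := by
  induction i generalizing f with
  | zero => simp
  | succ i ih =>
    rw [iteratedFDeriv_succ_apply_fderiv (hT.contDiff_apply_comp_add hf hc)]
    simp_rw [hT.fderiv_apply_comp_add hf hc, iteratedFDeriv_succ_apply_fderiv hf]
    exact ih (contDiff_fderiv_apply hf _) (hasCompactSupport_fderiv_apply hc _) _

end Distribution

lemma norm_le_of_forall_norm_apply_le {ι E F : Type*} [Fintype ι] [NormedAddCommGroup E]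
    [NormedSpace ℝ E] [NormedAddCommGroup F] [NormedSpace ℝ F]
    (A : ContinuousMultilinearMap ℝ (fun _ : ι => E) F) {M : ℝ} (hM : 0 ≤ M)
    (h : ∀ m : ι → E, ‖m‖ ≤ 1 → ‖A m‖ ≤ M) : ‖A‖ ≤ M := by
  refine A.opNorm_le_bound hM fun m => ?_
  by_cases hm : ∃ k, m k = 0
  · obtain ⟨k, hk⟩ := hm
    rw [A.map_coord_zero k hk, norm_zero]
    positivity
  · push Not at hm
    have hm' : m = fun k => ‖m k‖ • (‖m k‖⁻¹ • m k) := by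
      ext1 k
      rw [smul_inv_smul₀ (norm_ne_zero_iff.2 (hm k))]
    have h1 := h (fun k => ‖m k‖⁻¹ • m k) <| (pi_norm_le_iff_of_nonneg zero_le_one).2 fun k => by
      simp [norm_smul, hm k]
    have h2 : A m = (∏ k, ‖m k‖) • A (fun k => ‖m k‖⁻¹ • m k) := by
      rw [← A.map_smul_univ, ← hm']
    rw [h2, norm_smul, Real.norm_of_nonneg (by positivity), mul_comm]
    gcongr

section Nets

variable {n : ℕ}

lemma IsModerate.contDiff {E : Type} [NormedAddCommGroup E] [NormedSpace ℝ E] {u : ℝ → E → ℂ}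
    (hu : IsModerate univ u) {ε : ℝ} (hε : ε ∈ Ioc (0:ℝ) 1) : ContDiff ℝ ∞ (u ε) :=
  contDiffOn_univ.1 (hu.1 ε hε)

lemma exists_norm_iteratedFDeriv_mul_le {E : Type} [NormedAddCommGroup E] [NormedSpace ℝ E]
    {φ : E → ℂ} (hφ : ContDiff ℝ ∞ φ) {K : Set E} (hK : IsCompact K) (i : ℕ) :
    ∃ D > 0, ∀ v : E → ℂ, ContDiff ℝ ∞ v → ∀ x ∈ K, ∀ B, 0 ≤ B →
      (∀ k ≤ i, ‖iteratedFDeriv ℝ k v x‖ ≤ B) →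
      ‖iteratedFDeriv ℝ i (fun x => φ x * v x) x‖ ≤ D * B := by
  choose D hD using fun k : ℕ => hK.exists_bound_of_continuousOn
    (hφ.continuous_iteratedFDeriv (m := k) (by exact_mod_cast le_top)).continuousOn
  refine ⟨∑ k ∈ Finset.range (i + 1), (i.choose k : ℝ) * |D k| + 1, by positivity,
    fun v hv x hx B hB H => ?_⟩
  refine (norm_iteratedFDeriv_mul_le hφ hv x (by exact_mod_cast le_top)).trans ?_
  rw [add_mul, one_mul, Finset.sum_mul]
  refine le_add_of_le_of_nonneg (Finset.sum_le_sum fun k _ => ?_) hB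
  gcongr
  · exact (hD k x hx).trans (le_abs_self _)
  · exact H _ (Nat.sub_le _ _)

lemma IsModerate.smooth_mul {E : Type} [NormedAddCommGroup E] [NormedSpace ℝ E]
    {u : ℝ → E → ℂ} (hu : IsModerate univ u) {φ : E → ℂ} (hφ : ContDiff ℝ ∞ φ) :
    IsModerate univ fun ε x => φ x * u ε x := by
  refine ⟨fun ε hε => (hφ.mul (hu.contDiff hε)).contDiffOn, fun K hK _ i => ?_⟩
  obtain ⟨D, hD, hDm⟩ := exists_norm_iteratedFDeriv_mul_le hφ hK i
  obtain ⟨N, c, hc, η, hη, H⟩ := exists_moderate_bound_uniform (j := i)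
    (g := fun k ε x => ‖iteratedFDeriv ℝ k (u ε) x‖) fun k _ => hu.2 K hK (subset_univ _) k
  refine ⟨N, D * c, mul_pos hD hc, η, hη, fun ε hε x hx => ?_⟩
  rw [mul_assoc]
  exact hDm _ (hu.contDiff ⟨hε.1, hε.2.trans hη.2⟩) x hx _
    (mul_nonneg hc.le (Real.rpow_nonneg hε.1.le _)) (H ε hε x hx)

lemma CIsNegligible.add {z w : ℝ → ℂ} (hz : CIsNegligible z) (hw : CIsNegligible w) :
    CIsNegligible fun ε => z ε + w ε := by
  intro q
  obtain ⟨c, hc, η, hη, H⟩ := hz q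
  obtain ⟨c', hc', η', hη', H'⟩ := hw q
  refine ⟨c + c', add_pos hc hc', min η η', ⟨lt_min hη.1 hη'.1, min_le_of_left_le hη.2⟩,
    fun ε hε => ?_⟩
  rw [add_mul]
  exact norm_add_le_of_le (H ε ⟨hε.1, hε.2.trans (min_le_left _ _)⟩)
    (H' ε ⟨hε.1, hε.2.trans (min_le_right _ _)⟩)

lemma IsBasicNetC.isModerate_apply {T : ℝ → (Rn n → ℂ) →ₗ[ℂ] ℂ} (hT : IsBasicNetC univ T)
    {w : ℝ → Rn n → ℂ} (hw : IsModerate univ w) {K : Set (Rn n)} (hK : IsCompact K)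
    (hwK : ∀ ε ∈ Ioc (0:ℝ) 1, tsupport (w ε) ⊆ K) :
    CIsModerate fun ε => T ε (w ε) := by
  obtain ⟨j, N, η, hη, H⟩ := hT.2 K hK (subset_univ _)
  obtain ⟨N', c, hc, η', hη', H'⟩ := exists_moderate_bound_uniform (j := j)
    (g := fun k ε x => ‖iteratedFDeriv ℝ k (w ε) x‖) fun k _ => hw.2 K hK (subset_univ _) k
  refine ⟨N + N', c, hc, min η η', ⟨lt_min hη.1 hη'.1, min_le_of_left_le hη.2⟩, fun ε hε => ?_⟩
  have hε1 : ε ∈ Ioc (0:ℝ) η := ⟨hε.1, hε.2.trans (min_le_left _ _)⟩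
  have hε2 : ε ∈ Ioc (0:ℝ) η' := ⟨hε.1, hε.2.trans (min_le_right _ _)⟩
  have hε3 : ε ∈ Ioc (0:ℝ) 1 := ⟨hε.1, hε1.2.trans hη.2⟩
  refine (H ε hε1 (w ε) (hw.1 ε hε3) (hwK ε hε3) (c * ε ^ (-(N':ℝ)))
    (mul_nonneg hc.le (Real.rpow_nonneg hε.1.le _)) (H' ε hε2)).trans (le_of_eq ?_)
  push_cast
  rw [neg_add, Real.rpow_add hε.1]
  ring

/-- The derivatives of order `i` of `x ↦ T_ε (u_ε (x + ·))` on a compact set are dominated by the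
values of `T` on a single moderate net. -/
lemma exists_net_dominating_iteratedFDeriv {T : ℝ → (Rn n → ℂ) →ₗ[ℂ] ℂ}
    (hT : ∀ ε ∈ Ioc (0:ℝ) 1, IsDistributionOn univ (T ε)) {u : ℝ → Rn n → ℂ}
    (hu : IsModerate univ u) {K : Set (Rn n)} (hK : IsCompact K)
    (huK : ∀ ε ∈ Ioc (0:ℝ) 1, tsupport (u ε) ⊆ K) {C : Set (Rn n)} (hC : IsCompact C) (i : ℕ) :
    ∃ w : ℝ → Rn n → ℂ, IsModerate univ w ∧ (∀ ε ∈ Ioc (0:ℝ) 1, tsupport (w ε) ⊆ K - C) ∧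
      ∀ ε ∈ Ioc (0:ℝ) 1, ∀ x ∈ C,
        ‖iteratedFDeriv ℝ i (fun x => T ε fun y => u ε (x + y)) x‖ ≤ ‖T ε (w ε)‖ := by
  rcases C.eq_empty_or_nonempty with rfl | hne
  · refine ⟨fun _ _ => 0, ⟨fun ε _ => contDiffOn_const, fun K _ _ i => ⟨0, 1, one_pos, 1, by simp,
      fun ε hε x _ => ?_⟩⟩, fun ε _ => by simp [tsupport], by simp⟩
    have : iteratedFDeriv ℝ i (fun _ : Rn n => (0:ℂ)) x = 0 := by simp
    simp [this]
  have hmax : ∀ ε, ∃ p : Rn n × (Fin i → Rn n), ε ∈ Ioc (0:ℝ) 1 →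
      p.1 ∈ C ∧ ‖p.2‖ ≤ 1 ∧ ∀ x ∈ C, ∀ m : Fin i → Rn n, ‖m‖ ≤ 1 →
        ‖iteratedFDeriv ℝ i (fun x => T ε fun y => u ε (x + y)) x m‖ ≤
        ‖iteratedFDeriv ℝ i (fun x => T ε fun y => u ε (x + y)) p.1 p.2‖ := by
    intro ε
    by_cases hε : ε ∈ Ioc (0:ℝ) 1
    swap
    · exact ⟨(0, 0), fun h => absurd h hε⟩
    have hcs : HasCompactSupport (u ε) :=
      hK.of_isClosed_subset (isClosed_tsupport _) (huK ε hε)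
    have hv := (hT ε hε).contDiff_apply_comp_add (hu.contDiff hε) hcs
    have hcont := hv.continuous_iteratedFDeriv (m := i) (by exact_mod_cast le_top)
    obtain ⟨p, hp, hpmax⟩ := (hC.prod (isCompact_closedBall (0 : Fin i → Rn n) 1)).exists_isMaxOn
      (hne.prod ⟨0, by simp⟩)
      (f := fun p : Rn n × (Fin i → Rn n) =>
        ‖iteratedFDeriv ℝ i (fun x => T ε fun y => u ε (x + y)) p.1 p.2‖)
      (Continuous.continuousOn (by fun_prop))
    refine ⟨p, fun _ => ⟨hp.1, by simpa using hp.2, fun x hx m hm => ?_⟩⟩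
    exact hpmax (a := (x, m)) ⟨hx, by simpa using hm⟩
  choose p hp using hmax
  refine ⟨fun ε y => iteratedFDeriv ℝ i (u ε) ((p ε).1 + y) (p ε).2, ⟨fun ε hε => ?_,
    fun L hL _ l => ?_⟩, fun ε hε => ?_, fun ε hε x hx => ?_⟩
  · exact ((contDiff_iteratedFDeriv_apply (hu.contDiff hε) i (p ε).2).comp
      (contDiff_const.add contDiff_id)).contDiffOn
  · obtain ⟨N, c, hc, η, hη, H⟩ := hu.2 (C + L) (hC.add hL) (subset_univ _) (l + i)
    refine ⟨N, c, hc, η, hη, fun ε hε y hy => ?_⟩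
    have hε1 : ε ∈ Ioc (0:ℝ) 1 := ⟨hε.1, hε.2.trans hη.2⟩
    obtain ⟨hpC, hp1, -⟩ := hp ε hε1
    rw [iteratedFDeriv_comp_add_left (f := fun z => iteratedFDeriv ℝ i (u ε) z (p ε).2)]
    refine (norm_iteratedFDeriv_iteratedFDeriv_apply_le (hu.contDiff hε1) l i _ _).trans ?_
    refine le_trans ?_ (H ε hε _ (add_mem_add hpC hy))
    refine mul_le_of_le_one_left (norm_nonneg _) (Finset.prod_le_one (fun _ _ => norm_nonneg _) ?_)
    exact fun k _ => (norm_le_pi_norm _ k).trans hp1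
  · refine (tsupport_comp_const_add_subset _ _
      ((tsupport_iteratedFDeriv_apply_subset _ _ _).trans (huK ε hε))).trans fun y hy => ?_
    exact ⟨_, hy, _, (hp ε hε).1, by simp⟩
  · have hcs : HasCompactSupport (u ε) :=
      hK.of_isClosed_subset (isClosed_tsupport _) (huK ε hε)
    refine norm_le_of_forall_norm_apply_le _ (norm_nonneg _) fun m hm => ?_
    rw [← (hT ε hε).iteratedFDeriv_apply_comp_add (hu.contDiff hε) hcs]
    exact (hp ε hε).2.2 x hx m hm

lemma IsBasicNetC.isModerate_apply_comp_add {T : ℝ → (Rn n → ℂ) →ₗ[ℂ] ℂ}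
    (hT : IsBasicNetC univ T) {u : ℝ → Rn n → ℂ}
    (hu : IsModerate univ u) {K : Set (Rn n)} (hK : IsCompact K)
    (huK : ∀ ε ∈ Ioc (0:ℝ) 1, tsupport (u ε) ⊆ K) :
    IsModerate univ fun ε x => T ε fun y => u ε (x + y) := by
  refine ⟨fun ε hε => ?_, fun C hC _ i => ?_⟩
  · have hcs : HasCompactSupport (u ε) :=
      hK.of_isClosed_subset (isClosed_tsupport _) (huK ε hε)
    exact ((hT.1 ε hε).contDiff_apply_comp_add (hu.contDiff hε) hcs).contDiffOn
  · obtain ⟨w, hw, hwK, hle⟩ := exists_net_dominating_iteratedFDeriv hT.1 hu hK huK hC i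
    obtain ⟨N, c, hc, η, hη, H⟩ := hT.isModerate_apply hw (K := K - C)
      (by rw [sub_eq_add_neg]; exact hK.add hC.neg) hwK
    exact ⟨N, c, hc, η, hη, fun ε hε x hx =>
      (hle ε ⟨hε.1, hε.2.trans hη.2⟩ x hx).trans (H ε hε)⟩

/-- If `S` is additive modulo negligible nets, then multiplying by functions `χ` such that `S`
vanishes on all smooth multiples of `χ v` does not contribute to `S v`. -/
lemma CIsNegligible.of_prod_one_sub {S : (ℝ → Rn n → ℂ) → ℝ → ℂ}
    (hSadd : ∀ u v, IsModerate (univ : Set (Rn n)) u → IsModerate (univ : Set (Rn n)) v →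
      CIsNegligible (fun ε => S (fun ε' x => u ε' x + v ε' x) ε - S u ε - S v ε))
    {v : ℝ → Rn n → ℂ} (hv : IsModerate univ v) {ι : Type*} (t : Finset ι) (χ : ι → Rn n → ℂ)
    (hχ : ∀ i ∈ t, ContDiff ℝ ∞ (χ i))
    (h : ∀ i ∈ t, ∀ φ : Rn n → ℂ, ContDiff ℝ ∞ φ →
      CIsNegligible (S fun ε x => χ i x * φ x * v ε x))
    {φ : Rn n → ℂ} (hφ : ContDiff ℝ ∞ φ)
    (h1 : CIsNegligible (S fun ε x => (∏ i ∈ t, (1 - χ i x)) * φ x * v ε x)) :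
    CIsNegligible (S fun ε x => φ x * v ε x) := by
  classical
  induction t using Finset.induction_on generalizing φ with
  | empty => simpa using h1
  | insert i t hi ih =>
    have hi' := Finset.mem_insert_self i t
    have hχi := hχ i hi'
    have e1 := h i hi' φ hφ
    have e2 : CIsNegligible (S fun ε x => (1 - χ i x) * φ x * v ε x) := by
      refine ih (fun k hk => hχ k (Finset.mem_insert_of_mem hk))
        (fun k hk => h k (Finset.mem_insert_of_mem hk)) ((contDiff_const.sub hχi).mul hφ) ?_
      convert h1 using 4 with ε x
      rw [Finset.prod_insert hi]
      ring
    have e3 := hSadd _ _ (hv.smooth_mul (hχi.mul hφ))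
      (hv.smooth_mul ((contDiff_const (c := (1:ℂ)).sub hχi).mul hφ))
    have e4 : (fun ε x => χ i x * φ x * v ε x + (1 - χ i x) * φ x * v ε x) =
        fun ε x => φ x * v ε x := by
      ext ε x
      ring
    simp only [e4] at e3
    convert (e3.add e1).add e2 using 2 with ε
    ring

lemma IsNegligible.smooth_mul {E : Type} [NormedAddCommGroup E] [NormedSpace ℝ E]
    {v : ℝ → E → ℂ} (hv : IsModerate univ v) {φ : E → ℂ} (hφ : ContDiff ℝ ∞ φ) {C : Set E}
    (hC : IsCompact C) (hφC : tsupport φ ⊆ C)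
    (hvC : ∀ i q : ℕ, ∃ c > 0, ∃ η ∈ Ioc (0:ℝ) 1, ∀ ε ∈ Ioc (0:ℝ) η, ∀ x ∈ C,
      ‖iteratedFDeriv ℝ i (v ε) x‖ ≤ c * ε ^ (q:ℝ)) :
    IsNegligible univ fun ε x => φ x * v ε x := by
  refine ⟨(hv.smooth_mul hφ).1, fun K _ _ i q => ?_⟩
  obtain ⟨D, hD, hDm⟩ := exists_norm_iteratedFDeriv_mul_le hφ hC i
  obtain ⟨c, hc, η, hη, H⟩ := exists_bound_uniform (j := i)
    (g := fun k ε x => ‖iteratedFDeriv ℝ k (v ε) x‖) fun k _ => hvC k q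
  refine ⟨D * c, mul_pos hD hc, η, hη, fun ε hε x _ => ?_⟩
  have hpos : 0 ≤ c * ε ^ (q:ℝ) := mul_nonneg hc.le (Real.rpow_nonneg hε.1.le _)
  by_cases hx : x ∈ C
  · rw [mul_assoc]
    exact hDm _ (hv.contDiff ⟨hε.1, hε.2.trans hη.2⟩) x hx _ hpos (H ε hε x hx)
  · have hx' : x ∉ tsupport fun x => φ x * v ε x :=
      fun hm => hx (hφC (tsupport_mul_subset_left hm))
    rw [image_eq_zero_of_notMem_tsupport fun hm => hx' (tsupport_iteratedFDeriv_subset i hm),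
      norm_zero, mul_assoc]
    positivity

lemma exists_isCompact_forall_cIsNegligible {S : (ℝ → Rn n → ℂ) → ℝ → ℂ}
    (hScont : ∃ K : Set (Rn n), IsCompact K ∧ ∃ m : ℕ, ∃ M : ℝ,
      ∀ u, IsModerate (univ : Set (Rn n)) u → ∀ b : ℝ,
        (∃ c > 0, ∃ η ∈ Ioc (0:ℝ) 1, ∀ ε ∈ Ioc (0:ℝ) η, ∀ x ∈ K, ∀ i ≤ m,
          ‖iteratedFDeriv ℝ i (u ε) x‖ ≤ c * ε ^ b) →
        ∃ c > 0, ∃ η ∈ Ioc (0:ℝ) 1, ∀ ε ∈ Ioc (0:ℝ) η, ‖S u ε‖ ≤ c * ε ^ (b - M)) :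
    ∃ K : Set (Rn n), IsCompact K ∧ ∀ v, IsModerate univ v →
      (∀ i q : ℕ, ∃ c > 0, ∃ η ∈ Ioc (0:ℝ) 1, ∀ ε ∈ Ioc (0:ℝ) η, ∀ x ∈ K,
        ‖iteratedFDeriv ℝ i (v ε) x‖ ≤ c * ε ^ (q:ℝ)) →
      CIsNegligible (S v) := by
  obtain ⟨K, hK, m, M, H⟩ := hScont
  refine ⟨K, hK, fun v hv hvK q => ?_⟩
  obtain ⟨p, hp⟩ := exists_nat_ge (q + M)
  obtain ⟨c, hc, η, hη, h⟩ := H v hv p (exists_bound_uniform (j := m)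
    (g := fun k ε x => ‖iteratedFDeriv ℝ k (v ε) x‖) fun k _ => hvK k p)
  exact ⟨c, hc, η, hη, fun ε hε => (h ε hε).trans
    (mul_rpow_le_mul_rpow hc ⟨hε.1, hε.2.trans hη.2⟩ (by linarith))⟩

end Nets

end Colombeau

open scoped ContDiff

/-- Let `S ∈ L(G(ℝ^n),ℂ̃)` (a `ℂ̃`-linear continuous functional,
regarded as a compactly supported functional in `L(G_c(ℝ^n),ℂ̃)`), given at the level of
nets, and let `T` be a basic functional in `L(G_c(ℝ^n),ℂ̃)`.  Define the convolution
`S∗T ∈ L(G_c(ℝ^n),ℂ̃)` by `(S∗T)(u) = S_x(T_y(u(x+y)))`.  Then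
`supp (S∗T) ⊆ supp S + supp T`. -/
theorem statement7
    {n : ℕ}
    (S : (ℝ → Rn n → ℂ) → ℝ → ℂ)
    -- `S` maps (representatives of) generalized functions to generalized numbers
    (hS0 : ∀ u, IsModerate (univ : Set (Rn n)) u → CIsModerate (S u))
    -- `S` is well defined on classes
    (hSwd : ∀ u v, IsModerate (univ : Set (Rn n)) u → IsModerate (univ : Set (Rn n)) v →
      IsNegligible (univ : Set (Rn n)) (fun ε x => u ε x - v ε x) →
      CIsNegligible (fun ε => S u ε - S v ε))
    -- `S` is additive
    (hSadd : ∀ u v, IsModerate (univ : Set (Rn n)) u → IsModerate (univ : Set (Rn n)) v →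
      CIsNegligible (fun ε => S (fun ε' x => u ε' x + v ε' x) ε - S u ε - S v ε))
    -- `S` is `ℂ̃`-homogeneous
    (hSsmul : ∀ u, IsModerate (univ : Set (Rn n)) u → ∀ lam : ℝ → ℂ, CIsModerate lam →
      CIsNegligible (fun ε => S (fun ε' x => lam ε' * u ε' x) ε - lam ε * S u ε))
    -- `S` is continuous: `|S u|_e ≤ C · P_{K,m}(u)` in valuation form
    (hScont : ∃ K : Set (Rn n), IsCompact K ∧ ∃ m : ℕ, ∃ M : ℝ,
      ∀ u, IsModerate (univ : Set (Rn n)) u → ∀ b : ℝ,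
        (∃ c > 0, ∃ η ∈ Ioc (0:ℝ) 1, ∀ ε ∈ Ioc (0:ℝ) η, ∀ x ∈ K, ∀ i ≤ m,
          ‖iteratedFDeriv ℝ i (u ε) x‖ ≤ c * ε ^ b) →
        ∃ c > 0, ∃ η ∈ Ioc (0:ℝ) 1, ∀ ε ∈ Ioc (0:ℝ) η, ‖S u ε‖ ≤ c * ε ^ (b - M))
    (T : ℝ → (Rn n → ℂ) →ₗ[ℂ] ℂ) (hT : IsBasicNetC (univ : Set (Rn n)) T) :
    suppFunctional (fun u => S (fun ε x => T ε (fun y => u ε (x + y)))) ⊆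
      suppFunctional S + suppFunctional (fun u ε => T ε (u ε)) := by
  intro x₀ hx₀
  by_contra hsum
  refine hx₀ ?_
  obtain ⟨K, hK, hSK⟩ := exists_isCompact_forall_cIsNegligible hScont
  have hloc : ∀ p : Rn n, ∃ r > 0, (∃ W : Set (Rn n), Metric.closedBall p r ⊆ W ∧
      ∀ u : ℝ → Rn n → ℂ, IsModerate (univ : Set (Rn n)) u →
        (∃ K : Set (Rn n), IsCompact K ∧ K ⊆ W ∧ ∀ ε ∈ Ioc (0:ℝ) 1, tsupport (u ε) ⊆ K) →
        CIsNegligible (S u)) ∨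
      ∃ W : Set (Rn n), Metric.ball (x₀ - p) (r + r) ⊆ W ∧
      ∀ u : ℝ → Rn n → ℂ, IsModerate (univ : Set (Rn n)) u →
        (∃ K : Set (Rn n), IsCompact K ∧ K ⊆ W ∧ ∀ ε ∈ Ioc (0:ℝ) 1, tsupport (u ε) ⊆ K) →
        CIsNegligible fun ε => T ε (u ε) := by
    intro p
    by_cases hp : p ∈ suppFunctional S
    · have hq : x₀ - p ∉ suppFunctional fun u ε => T ε (u ε) :=
        fun hq => hsum ⟨p, hp, x₀ - p, hq, by simp⟩
      obtain ⟨W, hW, hpW, h⟩ := not_not.1 hq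
      obtain ⟨r, hr, hrW⟩ := Metric.isOpen_iff.1 hW _ hpW
      exact ⟨r / 2, half_pos hr, Or.inr ⟨W, by rwa [add_halves], h⟩⟩
    · obtain ⟨W, hW, hpW, h⟩ := not_not.1 hp
      obtain ⟨r, hr, hrW⟩ := Metric.nhds_basis_closedBall.mem_iff.1 (hW.mem_nhds hpW)
      exact ⟨r, hr, Or.inl ⟨W, hrW, h⟩⟩
  choose r hr hloc using hloc
  obtain ⟨t, -, htK⟩ := hK.elim_nhds_subcover (fun p => Metric.ball p (r p / 2))
    fun p _ => Metric.ball_mem_nhds p (half_pos (hr p))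
  refine ⟨⋂ p ∈ t, Metric.ball x₀ (r p), isOpen_biInter_finset fun p _ => Metric.isOpen_ball,
    mem_iInter₂.2 fun p _ => Metric.mem_ball_self (hr p), ?_⟩
  rintro u hu ⟨L, hL, hLW, huL⟩
  set v : ℝ → Rn n → ℂ := fun ε x => T ε fun y => u ε (x + y)
  have hv : IsModerate univ v := hT.isModerate_apply_comp_add hu hL huL
  let f : ∀ p : Rn n, ContDiffBump p := fun p =>
    ⟨r p / 2, r p, half_pos (hr p), half_lt_self (hr p)⟩
  let χ : Rn n → Rn n → ℂ := fun p x => (f p x : ℂ)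
  have hχ : ∀ p, ContDiff ℝ ∞ (χ p) := fun p =>
    Complex.ofRealCLM.contDiff.comp (f p).contDiff
  have hχsupp : ∀ p, tsupport (χ p) ⊆ Metric.closedBall p (r p) := fun p => by
    rw [← (f p).tsupport_eq]
    exact closure_mono fun x hx h => hx (by simp [χ, h])
  have key : CIsNegligible (S fun ε x => (1:ℂ) * v ε x) := by
    refine CIsNegligible.of_prod_one_sub hSadd hv t χ (fun p _ => hχ p) (fun p hpt φ hφ => ?_)
      contDiff_const ?_
    · have hψ : ContDiff ℝ ∞ fun x => χ p x * φ x := (hχ p).mul hφ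
      have hψsupp : tsupport (fun x => χ p x * φ x) ⊆ Metric.closedBall p (r p) :=
        tsupport_mul_subset_left.trans (hχsupp p)
      rcases hloc p with ⟨W, hW, hSW⟩ | ⟨W, hW, hTW⟩
      · exact hSW _ (hv.smooth_mul hψ) ⟨_, isCompact_closedBall p (r p), hW, fun ε _ =>
          tsupport_mul_subset_left.trans hψsupp⟩
      · have hneg := IsNegligible.smooth_mul hv hψ (isCompact_closedBall p (r p)) hψsupp ?_
        · exact hSK _ (hv.smooth_mul hψ) (hneg.2 K hK (subset_univ _))
        · intro i q
          obtain ⟨w, hw, hwL, hle⟩ := exists_net_dominating_iteratedFDeriv hT.1 hu hL huL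
            (isCompact_closedBall p (r p)) i
          have hLC : IsCompact (L - Metric.closedBall p (r p)) := by
            rw [sub_eq_add_neg]
            exact hL.add (isCompact_closedBall p (r p)).neg
          have hLCW : L - Metric.closedBall p (r p) ⊆ W := by
            refine Subset.trans ?_ hW
            rintro _ ⟨y, hy, z, hz, rfl⟩
            have hy' : dist y x₀ < r p := mem_iInter₂.1 (hLW hy) p hpt
            exact (dist_sub_sub_le y z x₀ p).trans_lt (add_lt_add_of_lt_of_le hy' hz)
          obtain ⟨c, hc, η, hη, H⟩ := hTW w hw ⟨_, hLC, hLCW, hwL⟩ q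
          exact ⟨c, hc, η, hη, fun ε hε x hx =>
            (hle ε ⟨hε.1, hε.2.trans hη.2⟩ x hx).trans (H ε hε)⟩
    · have hφ : ContDiff ℝ ∞ fun x => (∏ p ∈ t, (1 - χ p x)) * 1 :=
        (contDiff_prod fun p _ => contDiff_const.sub (hχ p)).mul contDiff_const
      refine hSK _ (hv.smooth_mul hφ) fun i q => ⟨1, one_pos, 1, by simp, fun ε hε x hx => ?_⟩
      obtain ⟨p, hpt, hxp⟩ := mem_iUnion₂.1 (htK hx)
      have hzero : (fun x => (∏ p ∈ t, (1 - χ p x)) * 1 * v ε x) =ᶠ[𝓝 x] fun _ => 0 := by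
        filter_upwards [Metric.isOpen_ball.mem_nhds hxp] with y hy
        have h1 : χ p y = 1 := by
          simp [χ, (f p).one_of_mem_closedBall (Metric.ball_subset_closedBall hy)]
        rw [Finset.prod_eq_zero hpt (by simp [h1])]
        simp
      rw [(hzero.iteratedFDeriv ℝ i).eq_of_nhds]
      have : iteratedFDeriv ℝ i (fun _ : Rn n => (0:ℂ)) x = 0 := by simp
      rw [this, norm_zero, one_mul]
      exact Real.rpow_nonneg hε.1.le _
  simpa only [one_mul] using key
end
end

section
/- Let T be a basic functional in L(G_c(ℝ^n),ℂ̃) and u ∈ G_c(ℝ^n), regarded as the functional v ↦ ∫_{ℝ^n} u(x)v(x)dx in L(G(ℝ^n),ℂ̃). Then the functional convolution u∗T defined by (u∗T)(v) = u_x(T_y(v(x+y))) coincides with the generalized function x ↦ T(u(x−·)) ∈ G(ℝ^n): for every v ∈ G_c(ℝ^n), (u∗T)(v) = ∫_{ℝ^n} v(z)T(u(z−·))dz. -/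
noncomputable section

open Set MeasureTheory Topology

open Colombeau

namespace Colombeau

open scoped ContDiff

section ParametricIntegral

variable {E X : Type*} [NormedAddCommGroup E] [NormedSpace ℝ E]
  [NormedAddCommGroup X] [NormedSpace ℝ X]

/-- The partial derivatives in the second variable of a jointly smooth map are jointly smooth. -/
lemma contDiff_uncurry_iteratedFDeriv {F : E → E → X}
    (hF : ContDiff ℝ ∞ (Function.uncurry F)) (i : ℕ) :
    ContDiff ℝ ∞ (Function.uncurry fun x y => iteratedFDeriv ℝ i (F x) y) := by
  induction i with
  | zero =>
    exact (continuousMultilinearCurryFin0 ℝ E X).symm.contDiff.comp hF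
  | succ i ih =>
    have hfd : ContDiff ℝ ∞
        (fun p : E × E => fderiv ℝ (iteratedFDeriv ℝ i (F p.1)) p.2) := by
      refine ContDiff.fderiv (m := ∞) (f := fun p : E × E => iteratedFDeriv ℝ i (F p.1))
        (g := Prod.snd) ?_ contDiff_snd (by simp)
      exact ih.comp ((contDiff_fst.comp contDiff_fst).prodMk contDiff_snd)
    have h := (continuousMultilinearCurryLeftEquiv ℝ (fun _ : Fin (i + 1) => E)
      X).symm.contDiff.comp hfd
    simp only [Function.uncurry_def, iteratedFDeriv_succ_eq_comp_left]
    exact h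

lemma iteratedFDeriv_eq_zero_of_notMem {f : E → X} {K : Set E} (hK : IsClosed K)
    (hf : ∀ y ∉ K, f y = 0) (i : ℕ) {y : E} (hy : y ∉ K) : iteratedFDeriv ℝ i f y = 0 := by
  have hsub : tsupport f ⊆ K :=
    closure_minimal (fun z hz => by_contra fun h => hz (hf z h)) hK
  exact image_eq_zero_of_notMem_tsupport fun h => hy (hsub (tsupport_iteratedFDeriv_subset i h))

variable [MeasurableSpace E] [BorelSpace E] {μ : Measure E} [IsFiniteMeasureOnCompacts μ]

/-- Differentiation under the integral sign for a jointly `C^1`, compactly supported map. -/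
lemma hasFDerivAt_integral_of_compact [CompleteSpace X] {G : E → E → X} {K₁ K₂ : Set E}
    (hK₁ : IsCompact K₁) (hK₂ : IsCompact K₂) (hG : ContDiff ℝ 1 (Function.uncurry G))
    (hG₁ : ∀ x ∉ K₁, ∀ y, G x y = 0) (hG₂ : ∀ x, ∀ y ∉ K₂, G x y = 0) (y : E) :
    HasFDerivAt (fun y => ∫ x, G x y ∂μ) (∫ x, fderiv ℝ (G x) y ∂μ) y := by
  have hcont : Continuous fun p : E × E => fderiv ℝ (G p.1) p.2 := by
    refine (ContDiff.fderiv (m := 1) (n := 0) (f := fun p : E × E => G p.1)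
        (g := Prod.snd) ?_ contDiff_snd (by simp)).continuous
    exact hG.comp ((contDiff_fst.comp contDiff_fst).prodMk contDiff_snd)
  have hzero₁ : ∀ x ∉ K₁, ∀ y, fderiv ℝ (G x) y = 0 := fun x hx y => by
    rw [show G x = fun _ => 0 from funext (hG₁ x hx)]; simp
  have hzero₂ : ∀ x, ∀ y ∉ K₂, fderiv ℝ (G x) y = 0 := fun x y hy => by
    have hsub : tsupport (G x) ⊆ K₂ :=
      closure_minimal (fun z hz => by_contra fun h => hz (hG₂ x z h)) hK₂.isClosed
    exact image_eq_zero_of_notMem_tsupport fun h => hy (hsub (tsupport_fderiv_subset ℝ h))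
  obtain ⟨M, hM⟩ := (hK₁.prod hK₂).exists_bound_of_continuousOn hcont.continuousOn
  have hint : ∀ y, Integrable (fun x => G x y) μ := fun y =>
    (hG.continuous.comp (Continuous.prodMk_left y)).integrable_of_hasCompactSupport
      (HasCompactSupport.intro hK₁ fun x hx => hG₁ x hx y)
  have hint' : Integrable (fun x => fderiv ℝ (G x) y) μ :=
    (hcont.comp (Continuous.prodMk_left y)).integrable_of_hasCompactSupport
      (HasCompactSupport.intro hK₁ fun x hx => hzero₁ x hx y)
  refine hasFDerivAt_integral_of_dominated_of_fderiv_le (s := univ)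
    (F := fun y x => G x y) (F' := fun y x => fderiv ℝ (G x) y)
    (bound := K₁.indicator fun _ => max M 0) Filter.univ_mem
    (Filter.Eventually.of_forall fun y => (hint y).aestronglyMeasurable) (hint y)
    hint'.aestronglyMeasurable (Filter.Eventually.of_forall fun x y _ => ?_)
    ((integrable_indicator_iff hK₁.measurableSet).2
      (integrableOn_const hK₁.measure_lt_top.ne))
    (Filter.Eventually.of_forall fun x y _ => ?_)
  · by_cases hx : x ∈ K₁
    · rw [indicator_of_mem hx]
      by_cases hy : y ∈ K₂
      · exact (hM (x, y) ⟨hx, hy⟩).trans (le_max_left _ _)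
      · simp [hzero₂ x y hy]
    · simp [hzero₁ x hx y, hx]
  · have : ContDiff ℝ 1 (G x) := hG.comp (contDiff_prodMk_right x)
    exact ((this.differentiable one_ne_zero) y).hasFDerivAt

lemma hasFDerivAt_integral_iteratedFDeriv [CompleteSpace X] {F : E → E → X} {K₁ K₂ : Set E}
    (hK₁ : IsCompact K₁) (hK₂ : IsCompact K₂) (hF : ContDiff ℝ ∞ (Function.uncurry F))
    (hF₁ : ∀ x ∉ K₁, ∀ y, F x y = 0) (hF₂ : ∀ x, ∀ y ∉ K₂, F x y = 0) (i : ℕ) (y : E) :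
    HasFDerivAt (fun y => ∫ x, iteratedFDeriv ℝ i (F x) y ∂μ)
      (∫ x, fderiv ℝ (iteratedFDeriv ℝ i (F x)) y ∂μ) y :=
  hasFDerivAt_integral_of_compact hK₁ hK₂
    ((contDiff_uncurry_iteratedFDeriv hF i).of_le (by simp))
    (fun x hx y => by
      rw [show F x = fun _ => 0 from funext (hF₁ x hx)]
      exact congrFun iteratedFDeriv_fun_zero y)
    (fun x y hy => iteratedFDeriv_eq_zero_of_notMem hK₂.isClosed (hF₂ x) i hy) y

lemma iteratedFDeriv_integral_of_compact [CompleteSpace X] {F : E → E → X} {K₁ K₂ : Set E}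
    (hK₁ : IsCompact K₁) (hK₂ : IsCompact K₂) (hF : ContDiff ℝ ∞ (Function.uncurry F))
    (hF₁ : ∀ x ∉ K₁, ∀ y, F x y = 0) (hF₂ : ∀ x, ∀ y ∉ K₂, F x y = 0) (i : ℕ) :
    iteratedFDeriv ℝ i (fun y => ∫ x, F x y ∂μ) = fun y => ∫ x, iteratedFDeriv ℝ i (F x) y ∂μ := by
  induction i with
  | zero =>
    funext y
    simp only [iteratedFDeriv_zero_eq_comp, Function.comp_apply]
    exact ((continuousMultilinearCurryFin0 ℝ E X).symm.toContinuousLinearEquiv.integral_comp_comm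
      _).symm
  | succ i ih =>
    funext y
    have hder := hasFDerivAt_integral_iteratedFDeriv (μ := μ) hK₁ hK₂ hF hF₁ hF₂ i y
    simp only [iteratedFDeriv_succ_eq_comp_left, Function.comp_apply]
    rw [ih, hder.fderiv]
    exact (ContinuousLinearEquiv.integral_comp_comm (𝕜 := ℝ) (E := E →L[ℝ] E [×i]→L[ℝ] X)
      (F := E [×(i + 1)]→L[ℝ] X) (μ := μ) (continuousMultilinearCurryLeftEquiv ℝ
        (fun _ : Fin (i + 1) => E) X).symm.toContinuousLinearEquiv
      fun x => fderiv ℝ (iteratedFDeriv ℝ i (F x)) y).symm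

lemma contDiff_integral_of_compact [CompleteSpace X] {F : E → E → X} {K₁ K₂ : Set E}
    (hK₁ : IsCompact K₁) (hK₂ : IsCompact K₂) (hF : ContDiff ℝ ∞ (Function.uncurry F))
    (hF₁ : ∀ x ∉ K₁, ∀ y, F x y = 0) (hF₂ : ∀ x, ∀ y ∉ K₂, F x y = 0) :
    ContDiff ℝ ∞ fun y => ∫ x, F x y ∂μ :=
  contDiff_of_differentiable_iteratedFDeriv fun i _ y => by
    rw [iteratedFDeriv_integral_of_compact hK₁ hK₂ hF hF₁ hF₂]
    exact (hasFDerivAt_integral_iteratedFDeriv hK₁ hK₂ hF hF₁ hF₂ i y).differentiableAt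

end ParametricIntegral

section Jets

variable {E : Type*} [NormedAddCommGroup E] [NormedSpace ℝ E]

/-- Smooth functions vanishing outside `K`. -/
def smoothSupportedIn (K : Set E) : Submodule ℂ (E → ℂ) where
  carrier := {f | ContDiff ℝ ∞ f ∧ ∀ y ∉ K, f y = 0}
  add_mem' hf hg := ⟨hf.1.add hg.1, fun y hy => by simp [hf.2 y hy, hg.2 y hy]⟩
  zero_mem' := ⟨contDiff_const, fun _ _ => rfl⟩
  smul_mem' c _ hf := ⟨hf.1.const_smul c, fun y hy => by simp [hf.2 y hy]⟩

variable {K : Set E} [CompactSpace K] {j : ℕ}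

/-- Families of continuous multilinear-map-valued functions on `K`, one for each order
at most `j`, with the maximum of the uniform norms. -/
def JetSpace (K : Set E) (j : ℕ) : Type _ :=
  (i : Fin (j + 1)) → C(K, E [×(i : ℕ)]→L[ℝ] ℂ)

instance : NormedAddCommGroup (JetSpace K j) :=
  inferInstanceAs (NormedAddCommGroup ((i : Fin (j + 1)) → C(K, E [×(i : ℕ)]→L[ℝ] ℂ)))

instance : NormedSpace ℂ (JetSpace K j) :=
  inferInstanceAs (NormedSpace ℂ ((i : Fin (j + 1)) → C(K, E [×(i : ℕ)]→L[ℝ] ℂ)))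

instance : CompleteSpace (JetSpace K j) :=
  inferInstanceAs (CompleteSpace ((i : Fin (j + 1)) → C(K, E [×(i : ℕ)]→L[ℝ] ℂ)))

lemma JetSpace.norm_apply_le (g : JetSpace K j) (i : Fin (j + 1)) (y : K) : ‖g i y‖ ≤ ‖g‖ :=
  ((g i).norm_coe_le_norm y).trans
    (norm_le_pi_norm (show (i : Fin (j + 1)) → C(K, E [×(i : ℕ)]→L[ℝ] ℂ) from g) i)

/-- Evaluation of a component of a jet at a point. -/
def JetSpace.evalAt (i : Fin (j + 1)) (y : K) : JetSpace K j →L[ℂ] E [×(i : ℕ)]→L[ℝ] ℂ :=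
  LinearMap.mkContinuous
    { toFun := fun g => g i y
      map_add' := fun _ _ => rfl
      map_smul' := fun _ _ => rfl } 1
    fun g => (g.norm_apply_le i y).trans (one_mul _).ge

/-- The derivatives of order at most `j`, as continuous functions on `K`. -/
def jet (K : Set E) [CompactSpace K] (j : ℕ) : smoothSupportedIn K →ₗ[ℂ] JetSpace K j where
  toFun f i := ⟨fun y => iteratedFDeriv ℝ i f.1 y,
    (f.2.1.continuous_iteratedFDeriv (by exact_mod_cast le_top)).comp continuous_subtype_val⟩
  map_add' f g := by
    funext i
    refine ContinuousMap.ext fun y => ?_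
    exact iteratedFDeriv_add_apply (f.2.1.of_le (by exact_mod_cast le_top)).contDiffAt
      (g.2.1.of_le (by exact_mod_cast le_top)).contDiffAt
  map_smul' c f := by
    funext i
    refine ContinuousMap.ext fun y => ?_
    exact iteratedFDeriv_const_smul_apply (f.2.1.of_le (by exact_mod_cast le_top)).contDiffAt

lemma jet_injective (K : Set E) [CompactSpace K] (j : ℕ) : Function.Injective (jet K j) := by
  refine (injective_iff_map_eq_zero _).2 fun f hf => Subtype.ext (funext fun y => ?_)
  by_cases hy : y ∈ K
  · have h : iteratedFDeriv ℝ 0 f.1 y = 0 := DFunLike.congr_fun (congrFun hf 0) ⟨y, hy⟩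
    simpa using congrArg norm h
  · exact f.2.2 y hy

/-- A linear functional bounded by the `C^j` seminorm on `K` factors through the `j`-jet. -/
lemma exists_extension_jet {C : ℝ} (S : (E → ℂ) →ₗ[ℂ] ℂ)
    (hS : ∀ f : smoothSupportedIn K, ‖S f‖ ≤ C * ‖jet K j f‖) :
    ∃ Φ : JetSpace K j →L[ℂ] ℂ,
      ∀ f : smoothSupportedIn K, Φ (jet K j f) = S f := by
  let e := LinearEquiv.ofInjective (jet K j) (jet_injective K j)
  let φ : LinearMap.range (jet K j) →ₗ[ℂ] ℂ :=
    S ∘ₗ (smoothSupportedIn K).subtype ∘ₗ e.symm.toLinearMap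
  have hφ : ∀ z, ‖φ z‖ ≤ C * ‖z‖ := fun z => by
    have h := hS (e.symm z)
    rwa [show jet K j (e.symm z) = z from congrArg Subtype.val (e.apply_symm_apply z)] at h
  obtain ⟨Φ, hΦ, -⟩ := exists_extension_norm_eq (LinearMap.range (jet K j)) (φ.mkContinuous C hφ)
  refine ⟨Φ, fun f => (hΦ (e f)).trans ?_⟩
  simp [φ]

variable [MeasurableSpace E] [BorelSpace E] {μ : Measure E} [IsFiniteMeasureOnCompacts μ]

/-- Distributions commute with integration of a smooth compactly supported family. -/
lemma integral_apply_of_compact {K₁ : Set E} (hK₁ : IsCompact K₁) {C : ℝ} (S : (E → ℂ) →ₗ[ℂ] ℂ)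
    (hS : ∀ f : smoothSupportedIn K, ‖S f‖ ≤ C * ‖jet K j f‖)
    {F : E → E → ℂ} (hF : ContDiff ℝ ∞ (Function.uncurry F))
    (hF₁ : ∀ x ∉ K₁, ∀ y, F x y = 0) (hF₂ : ∀ x, ∀ y ∉ K, F x y = 0) :
    ∫ x, S (F x) ∂μ = S fun y => ∫ x, F x y ∂μ := by
  have hK : IsCompact K := isCompact_iff_compactSpace.2 inferInstance
  obtain ⟨Φ, hΦ⟩ := exists_extension_jet S hS
  let f : E → smoothSupportedIn K := fun x =>
    ⟨F x, hF.comp (contDiff_prodMk_right x), hF₂ x⟩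
  let g : smoothSupportedIn K := ⟨fun y => ∫ x, F x y ∂μ,
    contDiff_integral_of_compact hK₁ hK hF hF₁ hF₂, fun y hy => by simp [hF₂ _ y hy]⟩
  have hcont : Continuous fun x => jet K j (f x) := by
    refine continuous_pi (A := fun i : Fin (j + 1) => C(K, E [×(i : ℕ)]→L[ℝ] ℂ)) fun i =>
      ContinuousMap.continuous_of_continuous_uncurry _ ?_
    exact (contDiff_uncurry_iteratedFDeriv hF i).continuous.comp
      (continuous_id.prodMap continuous_subtype_val)
  have hint : Integrable (fun x => jet K j (f x)) μ :=
    hcont.integrable_of_hasCompactSupport <| HasCompactSupport.intro hK₁ fun x hx => by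
      rw [show f x = 0 from Subtype.ext (funext (hF₁ x hx)), map_zero]
  have hjet : ∫ x, jet K j (f x) ∂μ = jet K j g := by
    funext i
    refine ContinuousMap.ext fun y => ?_
    have h := (JetSpace.evalAt i y).integral_comp_comm hint
    exact h.symm.trans
      (congrFun (iteratedFDeriv_integral_of_compact hK₁ hK hF hF₁ hF₂ i) y).symm
  calc ∫ x, S (F x) ∂μ = ∫ x, Φ (jet K j (f x)) ∂μ := by simp only [hΦ, f]
    _ = Φ (jet K j g) := by rw [Φ.integral_comp_comm hint, hjet]
    _ = S fun y => ∫ x, F x y ∂μ := hΦ g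

end Jets

lemma IsDistributionOn.integral_apply {n : ℕ} {S : (Rn n → ℂ) →ₗ[ℂ] ℂ}
    (hS : IsDistributionOn univ S) {K₁ K : Set (Rn n)} (hK₁ : IsCompact K₁) (hK : IsCompact K)
    {F : Rn n → Rn n → ℂ} (hF : ContDiff ℝ ∞ (Function.uncurry F))
    (hF₁ : ∀ x ∉ K₁, ∀ y, F x y = 0) (hF₂ : ∀ x, ∀ y ∉ K, F x y = 0) :
    ∫ x, S (F x) = S fun y => ∫ x, F x y := by
  have : CompactSpace K := isCompact_iff_compactSpace.1 hK
  obtain ⟨j, C, -, hC⟩ := hS K hK (subset_univ _)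
  refine integral_apply_of_compact (j := j) (C := C) hK₁ S (fun f => ?_) hF hF₁ hF₂
  refine hC f f.2.1.contDiffOn
    (closure_minimal (fun z hz => by_contra fun h => hz (f.2.2 z h)) hK.isClosed) _
    fun x hx i hi => ?_
  exact (jet K j f).norm_apply_le ⟨i, Nat.lt_succ_of_le hi⟩ ⟨x, hx⟩

/-- The convolution identity for a distribution and two test functions. -/
lemma IsDistributionOn.integral_mul_apply_add {n : ℕ} {S : (Rn n → ℂ) →ₗ[ℂ] ℂ}
    (hS : IsDistributionOn univ S) {u v : Rn n → ℂ} {Ku Kv : Set (Rn n)}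
    (hKu : IsCompact Ku) (hKv : IsCompact Kv)
    (hu : ContDiff ℝ ∞ u) (hv : ContDiff ℝ ∞ v)
    (huK : ∀ x ∉ Ku, u x = 0) (hvK : ∀ x ∉ Kv, v x = 0) :
    ∫ x, u x * S (fun y => v (x + y)) = ∫ z, v z * S fun y => u (z - y) := by
  have hK : IsCompact ((fun p : Rn n × Rn n => p.1 - p.2) '' (Kv ×ˢ Ku)) :=
    (hKv.prod hKu).image (by fun_prop)
  have h₁ := hS.integral_apply (F := fun x y => u x * v (x + y)) hKu hK
    ((hu.comp contDiff_fst).mul (hv.comp (contDiff_fst.add contDiff_snd)))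
    (fun x hx y => by simp [huK x hx])
    (fun x y hy => by
      by_contra h
      refine hy ⟨(x + y, x), ⟨by_contra fun h' => h ?_, by_contra fun h' => h ?_⟩, by simp⟩
      · simp [hvK _ h']
      · simp [huK _ h'])
  have h₂ := hS.integral_apply (F := fun z y => v z * u (z - y)) hKv hK
    ((hv.comp contDiff_fst).mul (hu.comp (contDiff_fst.sub contDiff_snd)))
    (fun x hx y => by simp [hvK x hx])
    (fun z y hy => by
      by_contra h
      refine hy ⟨(z, z - y), ⟨by_contra fun h' => h ?_, by_contra fun h' => h ?_⟩, by simp⟩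
      · simp [hvK _ h']
      · simp [huK _ h'])
  have hsmul : ∀ (c : ℂ) (f : Rn n → ℂ), S (fun y => c * f y) = c * S f :=
    fun c f => S.map_smul c f
  simp only [hsmul] at h₁ h₂
  rw [h₁, h₂]
  congr 1
  funext y
  rw [← integral_add_right_eq_self (fun z => v z * u (z - y)) y]
  simp only [add_sub_cancel_right, mul_comm]

end Colombeau

/-- Let `T` be a basic functional in `L(G_c(ℝ^n),ℂ̃)` and
`u ∈ G_c(ℝ^n)`, regarded as the functional `v ↦ ∫ u(x)v(x)dx` in `L(G(ℝ^n),ℂ̃)`.  Then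
the functional convolution `u∗T` defined by `(u∗T)(v) = u_x(T_y(v(x+y)))` coincides with
the generalized function `x ↦ T(u(x−·)) ∈ G(ℝ^n)`: for every `v ∈ G_c(ℝ^n)`,
`(u∗T)(v) = ∫ v(z) T(u(z−·)) dz`. -/
theorem statement8
    {n : ℕ}
    (T : ℝ → (Rn n → ℂ) →ₗ[ℂ] ℂ) (hT : IsBasicNetC (univ : Set (Rn n)) T)
    (u : ℝ → Rn n → ℂ) (hu : IsModerate (univ : Set (Rn n)) u)
    (huc : HasCmpSupp (univ : Set (Rn n)) u)
    (v : ℝ → Rn n → ℂ) (hv : IsModerate (univ : Set (Rn n)) v)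
    (hvc : HasCmpSupp (univ : Set (Rn n)) v) :
    CIsNegligible (fun ε =>
      (∫ x : Rn n, u ε x * T ε (fun y => v ε (x + y))) -
        ∫ z : Rn n, v ε z * T ε (fun y => u ε (z - y))) := by
  obtain ⟨Ku, hKu, -, hu'⟩ := huc
  obtain ⟨Kv, hKv, -, hv'⟩ := hvc
  refine fun q => ⟨1, one_pos, 1, ⟨one_pos, le_rfl⟩, fun ε hε => ?_⟩
  beta_reduce
  rw [(hT.1 ε hε).integral_mul_apply_add hKu hKv
    (contDiffOn_univ.1 (hu.1 ε hε)) (contDiffOn_univ.1 (hv.1 ε hε))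
    (fun x hx => image_eq_zero_of_notMem_tsupport fun h => hx (hu' ε hε h))
    (fun x hx => image_eq_zero_of_notMem_tsupport fun h => hx (hv' ε hε h)),
    sub_self, norm_zero, one_mul]
  exact Real.rpow_nonneg hε.1.le _
end
end

section
/- Let ρ ∈ C_c^∞(ℝ^n) with ∫_{ℝ^n} ρ(y)dy = 1 and ρ_δ(x) = δ^{-n}ρ(x/δ). If T is a basic functional in L(G_c(ℝ^n),ℂ̃), then for every q ∈ ℕ the convolution T_q := [(ρ_{ε^q})_ε]∗T, with representative x ↦ T_ε(ρ_{ε^q}(x−·)), belongs to G(ℝ^n), and T_q → T uniformly on bounded subsets of G_c(ℝ^n): for every bounded subset B of G_c(ℝ^n), sup_{u∈B}|(T_q − T)(u)|_e → 0 as q → ∞. -/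
noncomputable section

open Set MeasureTheory Topology

open Colombeau

section Calculus

set_option maxSynthPendingDepth 3

open scoped ContDiff

variable {E V : Type} [NormedAddCommGroup E] [NormedSpace ℝ E]
  [NormedAddCommGroup V] [NormedSpace ℝ V]

theorem fderiv_iteratedFDeriv_succ (f : E → V) (i : ℕ) (y : E) :
    fderiv ℝ (iteratedFDeriv ℝ (i + 1) f) y =
      ((continuousMultilinearCurryLeftEquiv ℝ (fun _ : Fin (i + 1) => E) V).symm :
        (E →L[ℝ] E [×i]→L[ℝ] V) →L[ℝ] E [×(i + 1)]→L[ℝ] V).comp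
        (fderiv ℝ (fderiv ℝ (iteratedFDeriv ℝ i f)) y) :=
  (continuousMultilinearCurryLeftEquiv ℝ (fun _ : Fin (i + 1) => E) V).symm.comp_fderiv
    (f := fderiv ℝ (iteratedFDeriv ℝ i f))

theorem norm_fderiv_fderiv_iteratedFDeriv (f : E → V) (i : ℕ) (y : E) :
    ‖fderiv ℝ (fderiv ℝ (iteratedFDeriv ℝ i f)) y‖ = ‖iteratedFDeriv ℝ (i + 2) f y‖ := by
  rw [← norm_fderiv_iteratedFDeriv, fderiv_iteratedFDeriv_succ]
  exact ((continuousMultilinearCurryLeftEquiv ℝ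
    (fun _ : Fin (i + 1) => E) V).symm.toLinearIsometry.norm_toContinuousLinearMap_comp).symm

/-- Iterated derivatives commute with directional derivatives. -/
theorem fderiv_iteratedFDeriv_apply_eq {f : E → V} (hf : ContDiff ℝ ∞ f) (h : E) (i : ℕ) :
    (fun y => fderiv ℝ (iteratedFDeriv ℝ i f) y h) =
      iteratedFDeriv ℝ i (fun y => fderiv ℝ f y h) := by
  induction i with
  | zero =>
    ext y m
    rw [iteratedFDeriv_zero_apply, iteratedFDeriv_zero_eq_comp,
      LinearIsometryEquiv.comp_fderiv]
    rfl
  | succ i ih =>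
    have hG : ContDiff ℝ ∞ (iteratedFDeriv ℝ i f) :=
      hf.iteratedFDeriv_right (m := ∞) (by exact_mod_cast le_top)
    have hD : Differentiable ℝ (fderiv ℝ (iteratedFDeriv ℝ i f)) :=
      (hG.fderiv_right (m := ∞) (by simp)).differentiable (by simp)
    ext y m
    rw [iteratedFDeriv_succ_apply_left, ← ih, fderiv_iteratedFDeriv_succ,
      fderiv_clm_apply hD.differentiableAt (by fun_prop)]
    have hs : IsSymmSndFDerivAt ℝ (iteratedFDeriv ℝ i f) y :=
      hG.contDiffAt.isSymmSndFDerivAt (by simpa using ENat.LEInfty.out)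
    have := hs h (m 0)
    simp only [fderiv_fun_const, Pi.zero_apply, ContinuousLinearMap.comp_zero, zero_add,
      ContinuousLinearMap.flip_apply, ← this]
    rfl

/-- A first-order Taylor estimate for functions with bounded second derivative. -/
theorem norm_sub_add_fderiv_le {G : E → V} (hG : ContDiff ℝ 2 G) {M : ℝ} (hM0 : 0 ≤ M)
    (hM : ∀ y, ‖fderiv ℝ (fderiv ℝ G) y‖ ≤ M) (y h : E) :
    ‖G (y - h) - G y + fderiv ℝ G y h‖ ≤ M * ‖h‖ ^ 2 := by
  have hD : Differentiable ℝ (fderiv ℝ G) :=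
    (hG.fderiv_right (m := 1) (by norm_num)).differentiable (by simp)
  have hGd : Differentiable ℝ G := hG.differentiable (by simp)
  have hlip (z : E) : ‖fderiv ℝ G z - fderiv ℝ G y‖ ≤ M * ‖z - y‖ :=
    convex_univ.norm_image_sub_le_of_norm_fderiv_le (fun x _ => hD x) (fun x _ => hM x)
      (mem_univ y) (mem_univ z)
  have := (convex_segment y (y - h)).norm_image_sub_le_of_norm_hasFDerivWithin_le'
    (f := G) (f' := fderiv ℝ G) (φ := fderiv ℝ G y) (C := M * ‖h‖)
    (fun x _ => (hGd x).hasFDerivAt.hasFDerivWithinAt)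
    (fun x hx => (hlip x).trans (by
      gcongr
      simpa using norm_sub_le_of_mem_segment hx))
    (left_mem_segment ℝ y (y - h)) (right_mem_segment ℝ y (y - h))
  simpa [pow_two, mul_assoc] using this

/-- The iterated derivatives of a compactly supported smooth function are bounded. -/
theorem exists_norm_iteratedFDeriv_le {f : E → V} (hf : ContDiff ℝ ∞ f)
    (hc : HasCompactSupport f) (k : ℕ) :
    ∃ M, 0 ≤ M ∧ ∀ i ≤ k, ∀ x, ‖iteratedFDeriv ℝ i f x‖ ≤ M := by
  have h (i : ℕ) : ∃ M, ∀ x, ‖iteratedFDeriv ℝ i f x‖ ≤ M :=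
    (hf.continuous_iteratedFDeriv (m := i)
      (by exact_mod_cast le_top)).bounded_above_of_compact_support (hc.iteratedFDeriv i)
  choose M hM using h
  refine ⟨∑ i ∈ Finset.range (k + 1), |M i|, by positivity, fun i hi x => ?_⟩
  exact (hM i x).trans ((le_abs_self _).trans
    (Finset.single_le_sum (f := fun i => |M i|) (fun i _ => abs_nonneg _)
      (Finset.mem_range.2 (by omega))))

theorem norm_iteratedFDeriv_sub_translate_le {f : E → V} (hf : ContDiff ℝ ∞ f) {i : ℕ} {M : ℝ}
    (hM : ∀ x, ‖iteratedFDeriv ℝ (i + 1) f x‖ ≤ M) (x y : E) :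
    ‖iteratedFDeriv ℝ i f x - iteratedFDeriv ℝ i f y‖ ≤ M * ‖x - y‖ :=
  convex_univ.norm_image_sub_le_of_norm_fderiv_le
    (fun z _ => (hf.differentiable_iteratedFDeriv
      (by exact_mod_cast ENat.natCast_lt_top i)).differentiableAt)
    (fun z _ => by rw [norm_fderiv_iteratedFDeriv]; exact hM z) (mem_univ y) (mem_univ x)

omit [NormedSpace ℝ E] [NormedSpace ℝ V] in
/-- Support of a translate of a function supported in a ball. -/
theorem tsupport_comp_sub_subset {f : E → V} {R R' : ℝ} {x : E}
    (hs : tsupport f ⊆ Metric.closedBall 0 R) (hx : ‖x‖ ≤ R') :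
    tsupport (fun y => f (y - x)) ⊆ Metric.closedBall 0 (R' + R) := by
  refine closure_minimal (fun y hy => ?_) Metric.isClosed_closedBall
  have := hs (subset_tsupport f (show y - x ∈ Function.support f from hy))
  rw [mem_closedBall_zero_iff] at this ⊢
  calc ‖y‖ = ‖x + (y - x)‖ := by congr 1; abel
    _ ≤ ‖x‖ + ‖y - x‖ := norm_add_le _ _
    _ ≤ R' + R := by gcongr

end Calculus

section Functional

set_option maxSynthPendingDepth 3

open scoped ContDiff

variable {E : Type} [NormedAddCommGroup E] [NormedSpace ℝ E]

/-- `‖S f‖ ≤ C * sup_{x ∈ K, i ≤ j} ‖∂^i f(x)‖` for all smooth `f` supported in `K`. -/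
def SeminormBound (S : (E → ℂ) →ₗ[ℂ] ℂ) (K : Set E) (j : ℕ) (C : ℝ) : Prop :=
  ∀ f : E → ℂ, ContDiff ℝ ∞ f → tsupport f ⊆ K → ∀ B : ℝ, 0 ≤ B →
    (∀ x ∈ K, ∀ i ≤ j, ‖iteratedFDeriv ℝ i f x‖ ≤ B) → ‖S f‖ ≤ C * B

variable [FiniteDimensional ℝ E]

/-- Differentiating `x ↦ S (ψ (· - x))` amounts to differentiating `ψ`. -/
theorem hasFDerivAt_translate {S : (E → ℂ) →ₗ[ℂ] ℂ}
    (hS : ∀ K : Set E, IsCompact K → ∃ j C, SeminormBound S K j C)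
    {ψ : E → ℂ} (hψ : ContDiff ℝ ∞ ψ) (hc : HasCompactSupport ψ) (x : E) :
    ∃ L : E →L[ℝ] ℂ, (∀ h, L h = -S (fun y => fderiv ℝ ψ (y - x) h)) ∧
      HasFDerivAt (fun x => S (fun y => ψ (y - x))) L x := by
  let L₀ : E →ₗ[ℝ] ℂ :=
    { toFun := fun h => -S (fun y => fderiv ℝ ψ (y - x) h)
      map_add' := fun h k => by
        have : (fun y => fderiv ℝ ψ (y - x) (h + k)) =
            (fun y => fderiv ℝ ψ (y - x) h) + fun y => fderiv ℝ ψ (y - x) k := by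
          ext y; simp
        rw [this, map_add, neg_add]
      map_smul' := fun c h => by
        have : (fun y => fderiv ℝ ψ (y - x) (c • h)) =
            (c : ℂ) • (fun y => fderiv ℝ ψ (y - x) h) := by
          ext y; simp
        rw [this, map_smul]
        simp }
  refine ⟨LinearMap.toContinuousLinearMap L₀, fun h => rfl, ?_⟩
  obtain ⟨R, hR⟩ := hc.isCompact.isBounded.subset_closedBall (0 : E)
  obtain ⟨j, C, hSb⟩ := hS _ (isCompact_closedBall (0 : E) (‖x‖ + 1 + R))
  obtain ⟨M, hM0, hM⟩ := exists_norm_iteratedFDeriv_le hψ hc (j + 2)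
  have key (h : E) (hh : ‖h‖ ≤ 1) :
      ‖S (fun y => ψ (y - (x + h))) - S (fun y => ψ (y - x)) - L₀ h‖ ≤ C * M * ‖h‖ ^ 2 := by
    let g : E → ℂ := fun y => ψ (y - h) - ψ y + fderiv ℝ ψ y h
    have hψ' : ContDiff ℝ ∞ (fun y => fderiv ℝ ψ y h) :=
      (hψ.fderiv_right (m := ∞) (by simp)).clm_apply contDiff_const
    have hψh : ContDiff ℝ ∞ (fun y => ψ (y - h)) := hψ.comp (contDiff_id.sub contDiff_const)
    have hg : ContDiff ℝ ∞ g := (hψh.sub hψ).add hψ'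
    have hgs : (fun y => g (y - x)) =
        (fun y => ψ (y - (x + h))) - (fun y => ψ (y - x)) + fun y => fderiv ℝ ψ (y - x) h := by
      ext y; simp [g, sub_sub]
    have hgt : tsupport g ⊆ Metric.closedBall 0 (1 + R) := by
      have hR1 : Metric.closedBall (0 : E) R ⊆ Metric.closedBall 0 (1 + R) :=
        Metric.closedBall_subset_closedBall (by linarith)
      refine (tsupport_add _ _).trans (union_subset ((tsupport_sub _ _).trans
        (union_subset (tsupport_comp_sub_subset hR hh) (hR.trans hR1))) ?_)
      exact (tsupport_fderiv_apply_subset ℝ h).trans (hR.trans hR1)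
    have hb := hSb (fun y => g (y - x)) (hg.comp (contDiff_id.sub contDiff_const))
      (by simpa [add_assoc] using tsupport_comp_sub_subset hgt le_rfl)
      (M * ‖h‖ ^ 2) (by positivity) (fun y _ i hi => by
        rw [iteratedFDeriv_comp_sub]
        have h1 : iteratedFDeriv ℝ i g = fun y => iteratedFDeriv ℝ i ψ (y - h) -
            iteratedFDeriv ℝ i ψ y + fderiv ℝ (iteratedFDeriv ℝ i ψ) y h := by
          ext1 y
          have e : fderiv ℝ (iteratedFDeriv ℝ i ψ) y h = _ :=
            congrFun (fderiv_iteratedFDeriv_apply_eq hψ h i) y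
          have hg' : g = (fun y => ψ (y - h)) - ψ + fun y => fderiv ℝ ψ y h := rfl
          have hd : ContDiff ℝ ∞ ((fun y => ψ (y - h)) - ψ) := hψh.sub hψ
          rw [e, hg', iteratedFDeriv_add_apply
            (hd.of_le (by exact_mod_cast le_top)).contDiffAt
            (hψ'.of_le (by exact_mod_cast le_top)).contDiffAt, iteratedFDeriv_sub_apply
            (hψh.of_le (by exact_mod_cast le_top)).contDiffAt
            (hψ.of_le (by exact_mod_cast le_top)).contDiffAt, iteratedFDeriv_comp_sub]
        rw [h1]
        refine norm_sub_add_fderiv_le ((hψ.iteratedFDeriv_right (m := ∞)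
          (by exact_mod_cast le_top)).of_le ENat.LEInfty.out) hM0
          (fun z => ?_) _ _
        rw [norm_fderiv_fderiv_iteratedFDeriv]
        exact hM (i + 2) (by omega) z)
    rw [hgs, map_add, map_sub] at hb
    have : L₀ h = - S (fun y => fderiv ℝ ψ (y - x) h) := rfl
    rw [this, sub_neg_eq_add]
    linarith
  rw [hasFDerivAt_iff_isLittleO_nhds_zero]
  refine Asymptotics.IsBigO.trans_isLittleO (g := fun h : E => ‖h‖ ^ 2) ?_
    (Asymptotics.isLittleO_norm_pow_id one_lt_two)
  refine Asymptotics.IsBigO.of_bound (C * M) ?_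
  filter_upwards [Metric.closedBall_mem_nhds (0 : E) one_pos] with h hh
  have := key h (by simpa using hh)
  simpa using this

theorem fderiv_translate {S : (E → ℂ) →ₗ[ℂ] ℂ}
    (hS : ∀ K : Set E, IsCompact K → ∃ j C, SeminormBound S K j C)
    {ψ : E → ℂ} (hψ : ContDiff ℝ ∞ ψ) (hc : HasCompactSupport ψ) (x h : E) :
    fderiv ℝ (fun x => S (fun y => ψ (y - x))) x h = -S (fun y => fderiv ℝ ψ (y - x) h) := by
  obtain ⟨L, hL, hd⟩ := hasFDerivAt_translate hS hψ hc x
  rw [hd.fderiv, hL]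

/-- The regularization `x ↦ S (ψ (· - x))` is smooth. -/
theorem contDiff_translate {S : (E → ℂ) →ₗ[ℂ] ℂ}
    (hS : ∀ K : Set E, IsCompact K → ∃ j C, SeminormBound S K j C)
    {ψ : E → ℂ} (hψ : ContDiff ℝ ∞ ψ) (hc : HasCompactSupport ψ) :
    ContDiff ℝ ∞ (fun x => S (fun y => ψ (y - x))) := by
  rw [contDiff_infty]
  intro k
  have hdiff {ψ : E → ℂ} (hψ : ContDiff ℝ ∞ ψ) (hc : HasCompactSupport ψ) :
      Differentiable ℝ (fun x => S (fun y => ψ (y - x))) := fun x =>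
    let ⟨_, _, hd⟩ := hasFDerivAt_translate hS hψ hc x
    hd.differentiableAt
  induction k generalizing ψ with
  | zero => exact contDiff_zero.2 (hdiff hψ hc).continuous
  | succ k ih =>
    push_cast
    refine contDiff_succ_iff_fderiv_apply.2 ⟨hdiff hψ hc, by simp, fun h => ?_⟩
    simp only [fderiv_translate hS hψ hc]
    exact (ih ((hψ.fderiv_right (m := ∞) (by simp)).clm_apply contDiff_const)
      (hc.fderiv_apply ℝ h)).neg

/-- Derivative bounds for the regularization `x ↦ S (ψ (· - x))`. -/
theorem norm_iteratedFDeriv_translate_le {S : (E → ℂ) →ₗ[ℂ] ℂ}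
    (hS : ∀ K : Set E, IsCompact K → ∃ j C, SeminormBound S K j C)
    {R R' C : ℝ} {j : ℕ} (hC : 0 ≤ C) (hb : SeminormBound S (Metric.closedBall 0 (R' + R)) j C)
    {ψ : E → ℂ} (hψ : ContDiff ℝ ∞ ψ) (hs : tsupport ψ ⊆ Metric.closedBall 0 R)
    (k : ℕ) {A : ℝ} (hA0 : 0 ≤ A) (hA : ∀ i ≤ j + k, ∀ y, ‖iteratedFDeriv ℝ i ψ y‖ ≤ A)
    {x : E} (hx : ‖x‖ ≤ R') :
    ‖iteratedFDeriv ℝ k (fun x => S (fun y => ψ (y - x))) x‖ ≤ C * A := by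
  have hcpt {ψ : E → ℂ} (hs : tsupport ψ ⊆ Metric.closedBall 0 R) : HasCompactSupport ψ :=
    (isCompact_closedBall (0 : E) R).of_isClosed_subset (isClosed_tsupport _) hs
  induction k generalizing ψ A with
  | zero =>
    rw [norm_iteratedFDeriv_zero]
    refine hb (fun y => ψ (y - x)) (hψ.comp (contDiff_id.sub contDiff_const))
      (tsupport_comp_sub_subset hs hx) A hA0 fun y _ i hi => ?_
    rw [iteratedFDeriv_comp_sub]
    exact hA i (by omega) _
  | succ k ih =>
    have hF := contDiff_translate hS hψ (hcpt hs)
    rw [← norm_iteratedFDeriv_fderiv]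
    refine ContinuousMultilinearMap.opNorm_le_bound (by positivity) fun m => ?_
    refine ContinuousLinearMap.opNorm_le_bound _ (by positivity) fun h => ?_
    rw [← iteratedFDeriv_clm_apply_const_apply (hF.fderiv_right (m := ∞) (by simp))
      (by exact_mod_cast le_top)]
    have hψ' : ContDiff ℝ ∞ (fun y => fderiv ℝ ψ y h) :=
      (hψ.fderiv_right (m := ∞) (by simp)).clm_apply contDiff_const
    have hn := ih (ψ := fun y => -fderiv ℝ ψ y h) (A := ‖h‖ * A) hψ'.neg
      (by
        rw [show (fun y => -fderiv ℝ ψ y h) = -(fun y => fderiv ℝ ψ y h) from rfl, tsupport_neg]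
        exact (tsupport_fderiv_apply_subset ℝ h).trans hs) (by positivity)
      (fun i hi y => by
        rw [show (fun y => -fderiv ℝ ψ y h) = -(fun y => fderiv ℝ ψ y h) from rfl,
          iteratedFDeriv_neg_apply, norm_neg]
        refine (norm_iteratedFDeriv_clm_apply_const
          (hψ.fderiv_right (m := ∞) (by simp)).contDiffAt (by exact_mod_cast le_top)).trans ?_
        rw [norm_iteratedFDeriv_fderiv]
        gcongr
        exact hA _ (by omega) y)
    have he : (fun x => fderiv ℝ (fun x => S (fun y => ψ (y - x))) x h) =
        fun x => S (fun y => -fderiv ℝ ψ (y - x) h) := by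
      ext z
      rw [fderiv_translate hS hψ (hcpt hs), ← map_neg]
      rfl
    rw [he]
    refine (ContinuousMultilinearMap.le_of_opNorm_le hn m).trans_eq (by ring)

end Functional

section Convolution

set_option maxSynthPendingDepth 3

open scoped ContDiff Convolution BoundedContinuousFunction

variable {E : Type} [NormedAddCommGroup E] [NormedSpace ℝ E] [FiniteDimensional ℝ E]
  [MeasurableSpace E] [BorelSpace E] {μ : Measure E} [μ.IsAddHaarMeasure]

theorem hasFDerivAt_integral_translate {V : Type} [NormedAddCommGroup V] [NormedSpace ℝ V]
    [NormedSpace ℂ V] [IsScalarTower ℝ ℂ V] [CompleteSpace V] {a : E → ℂ} (ha : Continuous a)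
    {u : E → V} (hu : ContDiff ℝ 1 u) (hc : HasCompactSupport u) (y : E) :
    HasFDerivAt (fun y => ∫ t, a t • u (y - t) ∂μ) (∫ t, a t • fderiv ℝ u (y - t) ∂μ) y :=
  hc.hasFDerivAt_convolution_right (ContinuousLinearMap.lsmul ℝ ℂ)
    (ha.locallyIntegrable (μ := μ)) hu y

/-- Iterated derivatives of a convolution fall on the smooth factor. -/
theorem iteratedFDeriv_integral_translate {a : E → ℂ} (ha : Continuous a) {u : E → ℂ}
    (hu : ContDiff ℝ ∞ u) (hc : HasCompactSupport u) (i : ℕ) :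
    iteratedFDeriv ℝ i (fun y => ∫ t, a t * u (y - t) ∂μ) =
      fun y => ∫ t, a t • iteratedFDeriv ℝ i u (y - t) ∂μ := by
  induction i with
  | zero =>
    ext1 y
    simp only [iteratedFDeriv_zero_eq_comp, Function.comp_def]
    have := (continuousMultilinearCurryFin0 ℝ E ℂ).symm.toContinuousLinearEquiv.integral_comp_comm
      (μ := μ) (fun t => a t * u (y - t))
    refine Eq.trans this.symm (integral_congr_ae (.of_forall fun t => ?_))
    ext m
    simp
  | succ i ih =>
    have hG : ContDiff ℝ ∞ (iteratedFDeriv ℝ i u) :=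
      hu.iteratedFDeriv_right (m := ∞) (by exact_mod_cast le_top)
    ext1 y
    rw [iteratedFDeriv_succ_eq_comp_left, ih, Function.comp_apply,
      (hasFDerivAt_integral_translate ha (hG.of_le (by exact_mod_cast le_top))
        (hc.iteratedFDeriv i) y).fderiv]
    exact ((continuousMultilinearCurryLeftEquiv ℝ (fun _ : Fin (i + 1) => E)
      ℂ).symm.toContinuousLinearEquiv.integral_comp_comm
      (μ := μ) (fun t => a t • fderiv ℝ (iteratedFDeriv ℝ i u) (y - t))).symm

theorem contDiff_integral_translate {a : E → ℂ} (ha : Continuous a) {u : E → ℂ}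
    (hu : ContDiff ℝ ∞ u) (hc : HasCompactSupport u) :
    ContDiff ℝ ∞ (fun y => ∫ t, a t * u (y - t) ∂μ) :=
  hc.contDiff_convolution_right (ContinuousLinearMap.lsmul ℝ ℂ)
    (ha.locallyIntegrable (μ := μ)) hu

omit [NormedSpace ℝ E] [FiniteDimensional ℝ E] [BorelSpace E] [μ.IsAddHaarMeasure] in
theorem tsupport_integral_translate_subset {a u : E → ℂ} {K : Set E} (hK : IsClosed K)
    (hs : ∀ t, a t ≠ 0 → tsupport (fun y => u (y - t)) ⊆ K) :
    tsupport (fun y => ∫ t, a t * u (y - t) ∂μ) ⊆ K := by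
  refine closure_minimal (fun y hy => ?_) hK
  by_contra hyK
  refine hy (integral_eq_zero_of_ae (.of_forall fun t => ?_))
  by_contra h
  have h' : a t * u (y - t) ≠ 0 := h
  rw [mul_ne_zero_iff] at h'
  exact hyK (hs t h'.1 (subset_tsupport (fun y => u (y - t)) h'.2))

/-- Bounded continuous families of jets of order `j`. -/
abbrev JetSpace (E : Type) [NormedAddCommGroup E] [NormedSpace ℝ E] (j : ℕ) :=
  E →ᵇ (∀ i : Fin (j + 1), E [×i]→L[ℝ] ℂ)

/-- The jet of order `j` of a compactly supported smooth function. -/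
def jet (j : ℕ) (f : E → ℂ) (hf : ContDiff ℝ ∞ f) (hc : HasCompactSupport f) : JetSpace E j :=
  BoundedContinuousFunction.ofNormedAddCommGroup
    (fun y (i : Fin (j + 1)) => iteratedFDeriv ℝ i f y)
    (continuous_pi fun i => hf.continuous_iteratedFDeriv (by exact_mod_cast le_top))
    (exists_norm_iteratedFDeriv_le hf hc j).choose fun x =>
      (pi_norm_le_iff_of_nonneg (exists_norm_iteratedFDeriv_le hf hc j).choose_spec.1).2
        fun i => (exists_norm_iteratedFDeriv_le hf hc j).choose_spec.2 i (by omega) x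

omit [FiniteDimensional ℝ E] [MeasurableSpace E] [BorelSpace E] in
/-- A functional with a seminorm bound extends to a continuous functional of the jet. -/
theorem SeminormBound.exists_extension {S : (E → ℂ) →ₗ[ℂ] ℂ} {K : Set E} {j : ℕ} {C : ℝ}
    (hb : SeminormBound S K j C) :
    ∃ Λ : JetSpace E j →L[ℂ] ℂ, ∀ f (hf : ContDiff ℝ ∞ f) (hc : HasCompactSupport f),
      tsupport f ⊆ K → Λ (jet j f hf hc) = S f := by
  let p : Submodule ℂ (JetSpace E j) :=
    { carrier := {g | ∃ f : E → ℂ, ContDiff ℝ ∞ f ∧ tsupport f ⊆ K ∧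
        ∀ y i, g y i = iteratedFDeriv ℝ i f y}
      zero_mem' := ⟨0, contDiff_const, by simp [tsupport], fun y i => by simp⟩
      add_mem' := by
        rintro g g' ⟨f, hf, hs, h⟩ ⟨f', hf', hs', h'⟩
        refine ⟨f + f', hf.add hf', (tsupport_add _ _).trans (union_subset hs hs'),
          fun y i => ?_⟩
        rw [iteratedFDeriv_add_apply (hf.of_le (by exact_mod_cast le_top)).contDiffAt
          (hf'.of_le (by exact_mod_cast le_top)).contDiffAt, ← h, ← h']
        rfl
      smul_mem' := by
        rintro c g ⟨f, hf, hs, h⟩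
        refine ⟨c • f, contDiff_const.smul hf,
          (tsupport_smul_subset_right (fun _ => c) f).trans hs, fun y i => ?_⟩
        rw [iteratedFDeriv_const_smul_apply (hf.of_le (by exact_mod_cast le_top)).contDiffAt, ← h]
        rfl }
  let ℓ : JetSpace E j →ₗ[ℂ] ℂ := S.comp
    ({ toFun := fun g y => g y 0 (fun _ => 0)
       map_add' := fun _ _ => rfl
       map_smul' := fun _ _ => rfl } : JetSpace E j →ₗ[ℂ] (E → ℂ))
  have hℓ (g : JetSpace E j) (f : E → ℂ) (h : ∀ y i, g y i = iteratedFDeriv ℝ i f y) :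
      ℓ g = S f := by
    change S (fun y => g y 0 (fun _ => 0)) = S f
    congr 1
    ext y
    rw [h]
    rfl
  obtain ⟨Λ, hΛ, -⟩ := exists_extension_norm_eq p
    ((ℓ.comp p.subtype).mkContinuous C fun ⟨g, f, hf, hs, h⟩ => by
      change ‖ℓ g‖ ≤ C * ‖g‖
      rw [hℓ g f h]
      refine hb f hf hs _ (norm_nonneg g) fun x _ i hi => ?_
      have := h x ⟨i, by omega⟩
      simp only at this
      rw [← this]
      exact (norm_le_pi_norm _ _).trans (g.norm_coe_le_norm x))
  refine ⟨Λ, fun f hf hc hs => ?_⟩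
  exact (hΛ ⟨jet j f hf hc, f, hf, hs, fun _ _ => rfl⟩).trans (hℓ _ f fun _ _ => rfl)

/-- A functional with a seminorm bound commutes with convolution integrals. -/
theorem SeminormBound.integral_translate {S : (E → ℂ) →ₗ[ℂ] ℂ} {K : Set E} (hK : IsClosed K)
    {j : ℕ} {C : ℝ} (hb : SeminormBound S K j C) {a : E → ℂ} (ha : Continuous a)
    (hac : HasCompactSupport a) {ψ : E → ℂ} (hψ : ContDiff ℝ ∞ ψ) (hc : HasCompactSupport ψ)
    (hwc : HasCompactSupport (fun y => ∫ t, a t * ψ (y - t) ∂μ))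
    (hs : ∀ t, a t ≠ 0 → tsupport (fun y => ψ (y - t)) ⊆ K) :
    ∫ x, S (fun y => ψ (y - x)) * a x ∂μ = S (fun y => ∫ t, a t * ψ (y - t) ∂μ) := by
  obtain ⟨Λ, hΛ⟩ := hb.exists_extension
  have hψt (x : E) : ContDiff ℝ ∞ (fun y => ψ (y - x)) := hψ.comp (contDiff_id.sub contDiff_const)
  have hct (x : E) : HasCompactSupport (fun y => ψ (y - x)) :=
    hc.comp_homeomorph (Homeomorph.subRight x)
  let J : E → JetSpace E j := fun x => jet j (fun y => ψ (y - x)) (hψt x) (hct x)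
  have hJa (x y : E) (i : Fin (j + 1)) : J x y i = iteratedFDeriv ℝ i ψ (y - x) :=
    iteratedFDeriv_comp_sub _ _ _
  obtain ⟨M, hM0, hM⟩ := exists_norm_iteratedFDeriv_le hψ hc (j + 1)
  have hJ : Continuous J := by
    refine (LipschitzWith.of_dist_le_mul (K := ⟨M, hM0⟩) fun x x' => ?_).continuous
    rw [dist_eq_norm, dist_eq_norm]
    refine (BoundedContinuousFunction.norm_le (by positivity)).2 fun y =>
      (pi_norm_le_iff_of_nonneg (by positivity)).2 fun i => ?_
    change ‖J x y i - J x' y i‖ ≤ M * ‖x - x'‖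
    rw [hJa, hJa]
    refine (norm_iteratedFDeriv_sub_translate_le hψ (hM _ (by omega)) _ _).trans_eq ?_
    rw [sub_sub_sub_cancel_left, norm_sub_rev]
  have hG : Continuous (fun x => a x • J x) := ha.smul hJ
  have hGi : Integrable (fun x => a x • J x) μ :=
    hG.integrable_of_hasCompactSupport (hac.smul_right)
  have hw := contDiff_integral_translate (μ := μ) ha hψ hc
  rw [← hΛ _ hw hwc (tsupport_integral_translate_subset hK hs)]
  have hJint : ∫ x, a x • J x ∂μ = jet j _ hw hwc := by
    ext1 y
    funext i
    let ev : JetSpace E j →L[ℝ] E [×i]→L[ℝ] ℂ :=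
      (ContinuousLinearMap.proj (R := ℝ) (φ := fun i : Fin (j + 1) => E [×i]→L[ℝ] ℂ) i).comp
        (BoundedContinuousFunction.evalCLM ℝ y)
    change ev (∫ x, a x • J x ∂μ) = iteratedFDeriv ℝ i _ y
    rw [← ev.integral_comp_comm hGi, iteratedFDeriv_integral_translate ha hψ hc]
    refine integral_congr_ae (.of_forall fun x => ?_)
    change a x • J x y i = _
    rw [hJa]
  rw [← hJint, ← Λ.integral_comp_comm hGi]
  refine integral_congr_ae (.of_forall fun x => ?_)
  change _ = Λ (a x • J x)
  rw [map_smul, smul_eq_mul, mul_comm]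
  by_cases h : a x = 0
  · simp [h]
  · rw [hΛ _ (hψt x) (hct x) (hs x h)]

end Convolution

section Mollifier

set_option maxSynthPendingDepth 3

open scoped ContDiff

variable {n : ℕ} {φ : Rn n → ℂ} {δ R : ℝ}

/-- The rescaling `φ_δ(z) = δ^{-n} φ(z/δ)`. -/
def mollifier (φ : Rn n → ℂ) (δ : ℝ) (z : Rn n) : ℂ := (δ ^ n)⁻¹ • φ (δ⁻¹ • z)

theorem contDiff_mollifier (hφ : ContDiff ℝ ∞ φ) (δ : ℝ) : ContDiff ℝ ∞ (mollifier φ δ) :=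
  (hφ.comp (contDiff_const_smul δ⁻¹)).const_smul (δ ^ n)⁻¹

theorem tsupport_mollifier_subset (hδ : 0 < δ) (hs : tsupport φ ⊆ Metric.closedBall 0 R) :
    tsupport (mollifier φ δ) ⊆ Metric.closedBall 0 (δ * R) := by
  refine closure_minimal (fun z hz => ?_) Metric.isClosed_closedBall
  have hz' : φ (δ⁻¹ • z) ≠ 0 := fun h => hz (by simp [mollifier, h])
  have := hs (subset_tsupport φ hz')
  rw [mem_closedBall_zero_iff, norm_smul, norm_inv, Real.norm_of_nonneg hδ.le,
    inv_mul_le_iff₀ hδ] at this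
  simpa using this

theorem norm_iteratedFDeriv_mollifier_le (hφ : ContDiff ℝ ∞ φ) (hδ : 0 < δ) (hδ1 : δ ≤ 1)
    {k : ℕ} {M : ℝ} (hM : ∀ i ≤ k, ∀ x, ‖iteratedFDeriv ℝ i φ x‖ ≤ M) {i : ℕ} (hi : i ≤ k)
    (x : Rn n) : ‖iteratedFDeriv ℝ i (mollifier φ δ) x‖ ≤ (δ ^ (n + k))⁻¹ * M := by
  have hφi : ContDiff ℝ i φ := hφ.of_le (by exact_mod_cast le_top)
  have hcs : ContDiff ℝ i (fun z => φ (δ⁻¹ • z)) := hφi.comp (contDiff_const_smul δ⁻¹)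
  have : mollifier φ δ = (δ ^ n)⁻¹ • fun z => φ (δ⁻¹ • z) := rfl
  rw [this, iteratedFDeriv_const_smul_apply hcs.contDiffAt,
    iteratedFDeriv_comp_const_smul (𝕜 := ℝ) δ⁻¹ hφi,
    norm_smul, norm_smul, pow_add, mul_inv, mul_assoc]
  rw [norm_inv, norm_pow, norm_pow, norm_inv, Real.norm_of_nonneg hδ.le, inv_pow]
  have := hM i hi (δ⁻¹ • x)
  gcongr ?_ * (?_ * ?_)
  exact inv_anti₀ (by positivity) (pow_le_pow_of_le_one hδ.le hδ1 hi)

theorem integral_mollifier (hδ : 0 < δ) : ∫ z, mollifier φ δ z = ∫ z, φ z := by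
  simp only [mollifier]
  rw [integral_smul, Measure.integral_comp_inv_smul_of_nonneg _ _ hδ.le,
    finrank_euclideanSpace_fin,
    inv_smul_smul₀ (by positivity)]

theorem integral_norm_mollifier (hδ : 0 < δ) : ∫ z, ‖mollifier φ δ z‖ = ∫ z, ‖φ z‖ := by
  simp only [mollifier, norm_smul]
  rw [integral_const_mul, Measure.integral_comp_inv_smul_of_nonneg volume (fun z => ‖φ z‖) hδ.le,
    finrank_euclideanSpace_fin, norm_inv, norm_pow, Real.norm_of_nonneg hδ.le, smul_eq_mul,
    inv_mul_cancel_left₀ (by positivity)]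

theorem norm_iteratedFDeriv_mollify_sub_le (hφ : ContDiff ℝ ∞ φ)
    (hs : tsupport φ ⊆ Metric.closedBall 0 R) (hφ1 : ∫ z, φ z = 1) (hδ : 0 < δ)
    {u : Rn n → ℂ} (hu : ContDiff ℝ ∞ u) (hc : HasCompactSupport u) {i : ℕ} {M : ℝ}
    (hM : ∀ x, ‖iteratedFDeriv ℝ (i + 1) u x‖ ≤ M) (y : Rn n) :
    ‖iteratedFDeriv ℝ i ((fun y => ∫ t, mollifier φ δ t * u (y - t)) - u) y‖ ≤
      M * (δ * R) * ∫ z, ‖φ z‖ := by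
  have hm := contDiff_mollifier hφ δ
  have hmc : HasCompactSupport (mollifier φ δ) :=
    (isCompact_closedBall _ _).of_isClosed_subset (isClosed_tsupport _)
      (tsupport_mollifier_subset hδ hs)
  have hM0 : 0 ≤ M := (norm_nonneg _).trans (hM 0)
  have hui : Continuous (iteratedFDeriv ℝ i u) :=
    hu.continuous_iteratedFDeriv (by exact_mod_cast le_top)
  have hi1 : Integrable (fun t => mollifier φ δ t • iteratedFDeriv ℝ i u (y - t)) :=
    (hm.continuous.smul (hui.comp
      (continuous_const.sub continuous_id))).integrable_of_hasCompactSupport hmc.smul_right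
  have hi0 : Integrable (mollifier φ δ) := hm.continuous.integrable_of_hasCompactSupport hmc
  rw [iteratedFDeriv_sub_apply ((contDiff_integral_translate hm.continuous hu hc).of_le
      (by exact_mod_cast le_top)).contDiffAt (hu.of_le (by exact_mod_cast le_top)).contDiffAt,
    iteratedFDeriv_integral_translate hm.continuous hu hc]
  have h1 : iteratedFDeriv ℝ i u y = ∫ t, mollifier φ δ t • iteratedFDeriv ℝ i u y := by
    rw [integral_smul_const, integral_mollifier hδ, hφ1, one_smul]
  rw [h1, ← integral_sub hi1 (hi0.smul_const _), ← integral_norm_mollifier hδ,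
    ← integral_const_mul]
  refine norm_integral_le_of_norm_le (hi0.norm.const_mul _) (.of_forall fun t => ?_)
  rw [← smul_sub, norm_smul, mul_comm]
  by_cases ht : mollifier φ δ t = 0
  · simp [ht]
  · have htR : ‖t‖ ≤ δ * R :=
      mem_closedBall_zero_iff.1 (tsupport_mollifier_subset hδ hs (subset_tsupport _ ht))
    gcongr
    refine (norm_iteratedFDeriv_sub_translate_le hu hM _ _).trans ?_
    rw [sub_sub_cancel_left, norm_neg]
    gcongr

/-- Quantitative convergence of the regularizations of `S` to `S`. -/
theorem SeminormBound.norm_integral_mollifier_sub_le (hφ : ContDiff ℝ ∞ φ)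
    (hs : tsupport φ ⊆ Metric.closedBall 0 R) (hφ1 : ∫ z, φ z = 1) (hR : 0 ≤ R)
    (hδ : 0 < δ) (hδ1 : δ ≤ 1) {S : (Rn n → ℂ) →ₗ[ℂ] ℂ} {R' C : ℝ} {j : ℕ}
    (hb : SeminormBound S (Metric.closedBall 0 (R' + R)) j C)
    {u : Rn n → ℂ} (hu : ContDiff ℝ ∞ u) (hus : tsupport u ⊆ Metric.closedBall 0 R') {M : ℝ}
    (hM : ∀ i ≤ j + 1, ∀ x, ‖iteratedFDeriv ℝ i u x‖ ≤ M) :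
    ‖(∫ x, S (fun y => mollifier φ δ (y - x)) * u x) - S u‖ ≤
      C * (M * (δ * R) * ∫ z, ‖φ z‖) := by
  have hM0 : 0 ≤ M := (norm_nonneg _).trans (hM 0 (by omega) 0)
  have hm := contDiff_mollifier hφ δ
  have hms : tsupport (mollifier φ δ) ⊆ Metric.closedBall 0 R :=
    (tsupport_mollifier_subset hδ hs).trans
      (Metric.closedBall_subset_closedBall (mul_le_of_le_one_left hR hδ1))
  have hcpt {r : ℝ} {f : Rn n → ℂ} (hf : tsupport f ⊆ Metric.closedBall 0 r) :
      HasCompactSupport f :=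
    (isCompact_closedBall _ _).of_isClosed_subset (isClosed_tsupport _) hf
  have hcl : IsClosed (Metric.closedBall (0 : Rn n) (R' + R)) := Metric.isClosed_closedBall
  have hst (t : Rn n) (ht : u t ≠ 0) :
      tsupport (fun y => mollifier φ δ (y - t)) ⊆ Metric.closedBall 0 (R' + R) :=
    tsupport_comp_sub_subset hms (mem_closedBall_zero_iff.1 (hus (subset_tsupport u ht)))
  have hws := tsupport_integral_translate_subset (μ := volume) hcl hst
  have hcomm : (fun y => ∫ t, u t * mollifier φ δ (y - t)) =
      fun y => ∫ t, mollifier φ δ t * u (y - t) := by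
    ext1 y
    rw [← integral_sub_left_eq_self _ volume y]
    simp only [sub_sub_cancel, mul_comm]
  rw [hb.integral_translate hcl hu.continuous (hcpt hus) hm (hcpt hms) (hcpt hws) hst,
    ← map_sub]
  rw [hcomm] at hws ⊢
  refine hb _ ((contDiff_integral_translate hm.continuous hu (hcpt hus)).sub hu)
    ((tsupport_sub _ _).trans (union_subset hws (hus.trans
      (Metric.closedBall_subset_closedBall (by linarith))))) _ (by positivity) fun x _ i hi => ?_
  exact norm_iteratedFDeriv_mollify_sub_le hφ hs hφ1 hδ hu (hcpt hus) (hM (i + 1) (by omega)) x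

end Mollifier

section Basic

open scoped ContDiff

variable {n : ℕ}

theorem Colombeau.IsDistributionOn.exists_seminormBound {S : (Rn n → ℂ) →ₗ[ℂ] ℂ}
    (hS : IsDistributionOn univ S) (K : Set (Rn n)) (hK : IsCompact K) :
    ∃ j C, SeminormBound S K j C := by
  obtain ⟨j, C, -, h⟩ := hS K hK (subset_univ K)
  exact ⟨j, C, fun f hf hs B _ hB => h f hf.contDiffOn hs B hB⟩

theorem Colombeau.IsBasicNetC.exists_seminormBound {T : ℝ → (Rn n → ℂ) →ₗ[ℂ] ℂ}
    (hT : IsBasicNetC univ T) (K : Set (Rn n)) (hK : IsCompact K) :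
    ∃ j N : ℕ, ∃ η ∈ Ioc (0:ℝ) 1, ∀ ε ∈ Ioc (0:ℝ) η,
      SeminormBound (T ε) K j (ε ^ (-(N:ℝ))) := by
  obtain ⟨j, N, η, hη, h⟩ := hT.2 K hK (subset_univ K)
  exact ⟨j, N, η, hη, fun ε hε f hf hs B hB0 hB => h ε hε f hf.contDiffOn hs B hB0 hB⟩

/-- The bounds defining a bounded family can be chosen uniformly in derivatives up to a given
order. -/
theorem exists_uniform_valuation_bound {B : Set (ℝ → Rn n → ℂ)} {K : Set (Rn n)}
    (hB : ∀ i : ℕ, ∃ b : ℝ, ∀ u ∈ B, ∃ c > 0, ∃ η ∈ Ioc (0:ℝ) 1, ∀ ε ∈ Ioc (0:ℝ) η,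
      ∀ x ∈ K, ‖iteratedFDeriv ℝ i (u ε) x‖ ≤ c * ε ^ b) (k : ℕ) :
    ∃ b : ℝ, ∀ u ∈ B, ∃ c > 0, ∃ η ∈ Ioc (0:ℝ) 1, ∀ ε ∈ Ioc (0:ℝ) η,
      ∀ i ≤ k, ∀ x ∈ K, ‖iteratedFDeriv ℝ i (u ε) x‖ ≤ c * ε ^ b := by
  induction k with
  | zero =>
    obtain ⟨b, hb⟩ := hB 0
    refine ⟨b, fun u hu => ?_⟩
    obtain ⟨c, hc, η, hη, h⟩ := hb u hu
    exact ⟨c, hc, η, hη, fun ε hε i hi x hx => Nat.le_zero.1 hi ▸ h ε hε x hx⟩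
  | succ k ih =>
    obtain ⟨b₁, hb₁⟩ := ih
    obtain ⟨b₂, hb₂⟩ := hB (k + 1)
    refine ⟨min b₁ b₂, fun u hu => ?_⟩
    obtain ⟨c₁, hc₁, η₁, hη₁, h₁⟩ := hb₁ u hu
    obtain ⟨c₂, hc₂, η₂, hη₂, h₂⟩ := hb₂ u hu
    refine ⟨max c₁ c₂, lt_max_of_lt_left hc₁, min η₁ η₂,
      ⟨lt_min hη₁.1 hη₂.1, (min_le_left _ _).trans hη₁.2⟩, fun ε hε i hi x hx => ?_⟩
    have hε₁ : ε ≤ η₁ := hε.2.trans (min_le_left _ _)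
    have hε₂ : ε ≤ η₂ := hε.2.trans (min_le_right _ _)
    have hε1 : ε ≤ 1 := hε₁.trans hη₁.2
    have hmono {b c : ℝ} (hc : 0 < c) (hc' : c ≤ max c₁ c₂) (hb : min b₁ b₂ ≤ b) :
        c * ε ^ b ≤ max c₁ c₂ * ε ^ min b₁ b₂ :=
      mul_le_mul hc' (Real.rpow_le_rpow_of_exponent_ge hε.1 hε1 hb)
        (Real.rpow_nonneg hε.1.le _) (hc.le.trans hc')
    rcases Nat.le_succ_iff.1 hi with hi | rfl
    · exact (h₁ ε ⟨hε.1, hε₁⟩ i hi x hx).trans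
        (hmono hc₁ (le_max_left _ _) (min_le_left _ _))
    · exact (h₂ ε ⟨hε.1, hε₂⟩ x hx).trans (hmono hc₂ (le_max_right _ _) (min_le_right _ _))

/-- The regularization of a basic functional by mollifiers of width `ε ^ q` is moderate. -/
theorem Colombeau.IsBasicNetC.isModerate_translate_mollifier {T : ℝ → (Rn n → ℂ) →ₗ[ℂ] ℂ}
    (hT : IsBasicNetC univ T) {φ : Rn n → ℂ} (hφ : ContDiff ℝ ∞ φ) {R : ℝ} (hR : 0 ≤ R)
    (hs : tsupport φ ⊆ Metric.closedBall 0 R) (q : ℕ) :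
    IsModerate univ (fun ε x => T ε (fun y => mollifier φ (ε ^ q) (y - x))) := by
  have hms {ε : ℝ} (hε : ε ∈ Ioc (0:ℝ) 1) :
      tsupport (mollifier φ (ε ^ q)) ⊆ Metric.closedBall 0 R :=
    (tsupport_mollifier_subset (pow_pos hε.1 q) hs).trans (Metric.closedBall_subset_closedBall
      (mul_le_of_le_one_left hR (pow_le_one₀ hε.1.le hε.2)))
  refine ⟨fun ε hε => (contDiff_translate (hT.1 ε hε).exists_seminormBound
    (contDiff_mollifier hφ _) ((isCompact_closedBall _ _).of_isClosed_subset
      (isClosed_tsupport _) (hms hε))).contDiffOn, fun K hK _ k => ?_⟩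
  obtain ⟨R', hR'⟩ := hK.isBounded.subset_closedBall (0 : Rn n)
  obtain ⟨j, N, η, hη, hb⟩ := hT.exists_seminormBound _ (isCompact_closedBall 0 (R' + R))
  obtain ⟨M, hM0, hM⟩ := exists_norm_iteratedFDeriv_le hφ
    ((isCompact_closedBall _ _).of_isClosed_subset (isClosed_tsupport _) hs) (j + k)
  refine ⟨N + q * (n + (j + k)), M + 1, by positivity, η, hη, fun ε hε x hx => ?_⟩
  have hε1 : ε ∈ Ioc (0:ℝ) 1 := ⟨hε.1, hε.2.trans hη.2⟩
  have hε0 : 0 < ε := hε.1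
  refine (norm_iteratedFDeriv_translate_le (hT.1 ε hε1).exists_seminormBound
    (Real.rpow_nonneg hε0.le _) (hb ε hε) (contDiff_mollifier hφ _) (hms hε1) k
    (A := ((ε ^ q) ^ (n + (j + k)))⁻¹ * M) (by positivity)
    (fun i hi y => norm_iteratedFDeriv_mollifier_le hφ (pow_pos hε0 q)
      (pow_le_one₀ hε0.le hε1.2) hM hi y) (mem_closedBall_zero_iff.1 (hR' hx))).trans ?_
  rw [← pow_mul, Real.rpow_neg hε0.le, Real.rpow_neg hε0.le, Real.rpow_natCast,
    Real.rpow_natCast, pow_add, mul_inv, mul_comm (M + 1), ← mul_assoc]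
  gcongr
  linarith

/-- The regularizations of a basic functional by mollifiers of width `ε ^ q` converge to it
uniformly on bounded sets as `q → ∞`. -/
theorem Colombeau.IsBasicNetC.norm_integral_mollifier_sub_le {T : ℝ → (Rn n → ℂ) →ₗ[ℂ] ℂ}
    (hT : IsBasicNetC univ T) {φ : Rn n → ℂ} (hφ : ContDiff ℝ ∞ φ) {R : ℝ} (hR : 0 ≤ R)
    (hs : tsupport φ ⊆ Metric.closedBall 0 R) (hφ1 : ∫ z, φ z = 1)
    {B : Set (ℝ → Rn n → ℂ)} {K : Set (Rn n)} (hK : IsCompact K)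
    (hBm : ∀ u ∈ B, IsModerate univ u) (hBK : ∀ u ∈ B, ∀ ε ∈ Ioc (0:ℝ) 1, tsupport (u ε) ⊆ K)
    (hB : ∀ i : ℕ, ∃ b : ℝ, ∀ u ∈ B, ∃ c > 0, ∃ η ∈ Ioc (0:ℝ) 1, ∀ ε ∈ Ioc (0:ℝ) η,
      ∀ x ∈ K, ‖iteratedFDeriv ℝ i (u ε) x‖ ≤ c * ε ^ b) (r : ℝ) :
    ∃ Q : ℕ, ∀ q ≥ Q, ∀ u ∈ B, ∃ c > 0, ∃ η ∈ Ioc (0:ℝ) 1, ∀ ε ∈ Ioc (0:ℝ) η,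
      ‖(∫ x, T ε (fun y => mollifier φ (ε ^ q) (y - x)) * u ε x) - T ε (u ε)‖ ≤
        c * ε ^ r := by
  obtain ⟨R', hR'⟩ := hK.isBounded.subset_closedBall (0 : Rn n)
  obtain ⟨j, N, η₁, hη₁, hb⟩ := hT.exists_seminormBound _ (isCompact_closedBall 0 (R' + R))
  obtain ⟨b, hBb⟩ := exists_uniform_valuation_bound hB (j + 1)
  refine ⟨⌈r + N - b⌉₊, fun q hq u hu => ?_⟩
  obtain ⟨c, hc, η₂, hη₂, h⟩ := hBb u hu
  have hA : 0 ≤ ∫ z, ‖φ z‖ := integral_nonneg fun _ => norm_nonneg _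
  refine ⟨c * R * (∫ z, ‖φ z‖) + 1, by positivity, min η₁ η₂,
    ⟨lt_min hη₁.1 hη₂.1, (min_le_left _ _).trans hη₁.2⟩, fun ε hε => ?_⟩
  have hε0 : 0 < ε := hε.1
  have hε₁ : ε ≤ η₁ := hε.2.trans (min_le_left _ _)
  have hε1 : ε ∈ Ioc (0:ℝ) 1 := ⟨hε0, hε₁.trans hη₁.2⟩
  have hM (i : ℕ) (hi : i ≤ j + 1) (x : Rn n) : ‖iteratedFDeriv ℝ i (u ε) x‖ ≤ c * ε ^ b := by
    by_cases hx : x ∈ K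
    · exact h ε ⟨hε0, hε.2.trans (min_le_right _ _)⟩ i hi x hx
    · have : iteratedFDeriv ℝ i (u ε) x = 0 := by
        by_contra h0
        exact hx (hBK u hu ε hε1 (support_iteratedFDeriv_subset i h0))
      rw [this, norm_zero]
      positivity
  refine ((hb ε ⟨hε0, hε₁⟩).norm_integral_mollifier_sub_le hφ hs hφ1 hR (pow_pos hε0 q)
    (pow_le_one₀ hε0.le hε1.2) (contDiffOn_univ.1 ((hBm u hu).1 ε hε1))
    ((hBK u hu ε hε1).trans hR') hM).trans ?_
  calc ε ^ (-(N:ℝ)) * (c * ε ^ b * (ε ^ q * R) * ∫ z, ‖φ z‖)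
      = c * R * (∫ z, ‖φ z‖) * ε ^ (-(N:ℝ) + b + q) := by
        rw [Real.rpow_add hε0, Real.rpow_add hε0, Real.rpow_natCast]
        ring
    _ ≤ (c * R * (∫ z, ‖φ z‖) + 1) * ε ^ r := by
        refine mul_le_mul (by linarith) (Real.rpow_le_rpow_of_exponent_ge hε0 hε1.2 ?_)
          (Real.rpow_nonneg hε0.le _) (by positivity)
        have := Nat.ceil_le.1 hq
        linarith

end Basic

/-- Let `ρ ∈ C_c^∞(ℝ^n)` with `∫ ρ = 1` and `ρ_δ(x) = δ^{-n} ρ(x/δ)`.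
If `T` is a basic functional in `L(G_c(ℝ^n),ℂ̃)`, then for every `q ∈ ℕ` the convolution
`T_q := [(ρ_{ε^q})_ε] ∗ T`, with representative `x ↦ T_ε(ρ_{ε^q}(x−·))`, belongs to
`G(ℝ^n)`, and `T_q → T` uniformly on bounded subsets of `G_c(ℝ^n)`: for every bounded
subset `B` of `G_c(ℝ^n)`, `sup_{u∈B} |(T_q − T)(u)|_e → 0` as `q → ∞` (equivalently, the
valuations of `(T_q − T)(u)` tend to `+∞` uniformly for `u ∈ B`). -/
theorem statement9
    {n : ℕ}
    (ρ : Rn n → ℝ) (hρs : ContDiff ℝ (⊤ : ℕ∞) ρ) (hρc : HasCompactSupport ρ)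
    (hρ1 : ∫ y : Rn n, ρ y = 1)
    (T : ℝ → (Rn n → ℂ) →ₗ[ℂ] ℂ) (hT : IsBasicNetC (univ : Set (Rn n)) T) :
    -- `T_q = [(ρ_{ε^q})_ε] ∗ T` is a Colombeau function for every `q`
    (∀ q : ℕ, IsModerate (univ : Set (Rn n))
      (fun ε x => T ε (fun y => ((((ε ^ q) ^ n)⁻¹ * ρ ((ε ^ q)⁻¹ • (x - y)) : ℝ) : ℂ)))) ∧
    -- uniform convergence `T_q → T` on bounded subsets of `G_c(ℝ^n)`
    (∀ B : Set (ℝ → Rn n → ℂ), ∀ K : Set (Rn n), IsCompact K →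
      (∀ u ∈ B, IsModerate (univ : Set (Rn n)) u) →
      (∀ u ∈ B, ∀ ε ∈ Ioc (0:ℝ) 1, tsupport (u ε) ⊆ K) →
      -- `B` is bounded: every ultra-pseudo-seminorm `P_{K,i}` is bounded on `B`
      (∀ i : ℕ, ∃ b : ℝ, ∀ u ∈ B, ∃ c > 0, ∃ η ∈ Ioc (0:ℝ) 1, ∀ ε ∈ Ioc (0:ℝ) η,
        ∀ x ∈ K, ‖iteratedFDeriv ℝ i (u ε) x‖ ≤ c * ε ^ b) →
      ∀ r : ℝ, ∃ Q : ℕ, ∀ q ≥ Q, ∀ u ∈ B,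
        ∃ c > 0, ∃ η ∈ Ioc (0:ℝ) 1, ∀ ε ∈ Ioc (0:ℝ) η,
          ‖(∫ x : Rn n,
              T ε (fun y => ((((ε ^ q) ^ n)⁻¹ * ρ ((ε ^ q)⁻¹ • (x - y)) : ℝ) : ℂ)) * u ε x) -
            T ε (u ε)‖ ≤ c * ε ^ r) := by
  let φ : Rn n → ℂ := fun z => (ρ (-z) : ℂ)
  have hφ : ContDiff ℝ (⊤ : ℕ∞) φ := Complex.ofRealCLM.contDiff.comp (hρs.comp contDiff_neg)
  have hφc : HasCompactSupport φ :=
    (hρc.comp_homeomorph (Homeomorph.neg (Rn n))).comp_left Complex.ofReal_zero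
  have hφ1 : ∫ z, φ z = 1 := by
    rw [integral_complex_ofReal, integral_neg_eq_self ρ, hρ1, Complex.ofReal_one]
  obtain ⟨R, hR, hs⟩ := hφc.isCompact.isBounded.subset_closedBall_lt 0 (0 : Rn n)
  have he (q : ℕ) (ε : ℝ) (x y : Rn n) :
      ((((ε ^ q) ^ n)⁻¹ * ρ ((ε ^ q)⁻¹ • (x - y)) : ℝ) : ℂ) = mollifier φ (ε ^ q) (y - x) := by
    simp only [mollifier, φ, ← smul_neg, neg_sub, Complex.real_smul, Complex.ofReal_mul]
  simp only [he]
  exact ⟨hT.isModerate_translate_mollifier hφ hR.le hs, fun B K hK hBm hBK hB =>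
    hT.norm_integral_mollifier_sub_le hφ hR.le hs hφ1 hK hBm hBK hB⟩
end
end
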